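/- arXiv:2108.00919 — 6 statements merged into one kernel-verified Lean document; each statement's English description precedes it below -/
import Mathlib

section
/- There exists a function f : ℕ → ℕ such that the following holds. Let C be a positive integer and G a finite group admitting an automorphism α whose order is coprime to |G|, with G = [G,α]. Suppose that |[P,α]| ≤ C for every prime p and every Sylow p-subgroup P of G with α(P) = P. Then |G| ≤ f(C). -/
namespace CoprimeAut

/-- A permutation of prime period `q` on a set of size prime to `q` has a fixed point. -/
lemma exists_fixed {T : Type*} [Finite T] (S : Set T) (f : Equiv.Perm T) (q : ℕ) (hq : q.Prime)
    (hS : ∀ x, f x ∈ S ↔ x ∈ S) (hf : ∀ x ∈ S, (f ^ q) x = x) (hc : ¬ q ∣ Nat.card S) :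
    ∃ a ∈ S, f a = a := by
  classical
  have : Fact q.Prime := ⟨hq⟩
  have : Fintype S := Fintype.ofFinite S
  let g : Equiv.Perm S := f.subtypePerm hS
  have hg : g ^ q ^ 1 = 1 := by
    rw [pow_one]
    ext x
    simp only [g, Equiv.Perm.subtypePerm_pow, Equiv.Perm.subtypePerm_apply, Equiv.Perm.coe_one, id]
    exact hf x x.2
  rw [Nat.card_eq_fintype_card] at hc
  obtain ⟨a, ha⟩ := Equiv.Perm.exists_fixed_point_of_prime hc hg
  exact ⟨a, a.2, congrArg Subtype.val ha⟩

/-- The fixed subgroup of an automorphism. -/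
def fixSub {G : Type*} [Group G] (β : MulAut G) : Subgroup G where
  carrier := {g | β g = g}
  one_mem' := by simp
  mul_mem' := by intro a b ha hb; simp only [Set.mem_ofPred_eq] at *; simp [ha, hb]
  inv_mem' := by intro a ha; simp only [Set.mem_ofPred_eq] at *; simp [ha]

lemma mem_fixSub {G : Type*} [Group G] (β : MulAut G) (g : G) : g ∈ fixSub β ↔ β g = g := Iff.rfl

lemma compat_pow {G X : Type*} [Group G] [MulAction G X] (β : MulAut G) (τ : Equiv.Perm X)
    (h : ∀ (g : G) (x : X), τ (g • x) = β g • τ x) (k : ℕ) :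
    ∀ (g : G) (x : X), (τ ^ k) (g • x) = (β ^ k) g • (τ ^ k) x := by
  induction k with
  | zero => intro g x; simp
  | succ k ih => intro g x; simp [pow_succ, h, ih]

lemma glauberman_step {G X : Type*} [Group G] [Finite G] [Finite X] [MulAction G X]
    (β : MulAut G) (τ : Equiv.Perm X)
    (h : ∀ (g : G) (x : X), τ (g • x) = β g • τ x) (q : ℕ) (hq : q.Prime)
    (hc : ¬ q ∣ Nat.card G)
    (h0 : ∃ x, (τ ^ q) x = x)
    (ht : ∀ x y, (τ ^ q) x = x → (τ ^ q) y = y → ∃ g, (β ^ q) g = g ∧ g • x = y) :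
    (∃ x, τ x = x) ∧ ∀ x y, τ x = x → τ y = y → ∃ g, β g = g ∧ g • x = y := by
  have hq' := compat_pow β τ h q
  constructor
  · obtain ⟨x0, hx0⟩ := h0
    have hY : {x | (τ ^ q) x = x} = MulAction.orbit (fixSub (β ^ q)) x0 := by
      ext y
      constructor
      · intro hy
        obtain ⟨g, hg, hgy⟩ := ht x0 y hx0 hy
        exact ⟨⟨g, hg⟩, hgy⟩
      · rintro ⟨⟨g, hg⟩, rfl⟩
        change (τ ^ q) (g • x0) = g • x0
        rw [hq', hx0, (mem_fixSub _ _).1 hg]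
    obtain ⟨a, -, ha⟩ := exists_fixed {x | (τ ^ q) x = x} τ q hq (by
      intro x
      simp only [Set.mem_ofPred_eq]
      rw [← Equiv.Perm.mul_apply, ← pow_succ, pow_succ', Equiv.Perm.mul_apply]
      exact τ.injective.eq_iff) (fun x hx => hx) (by
      intro hd
      apply hc
      refine hd.trans ?_
      rw [hY]
      refine dvd_trans ?_ (Subgroup.card_subgroup_dvd_card (fixSub (β ^ q)))
      rw [Nat.card_congr (MulAction.orbitEquivQuotientStabilizer (fixSub (β ^ q)) x0)]
      exact Subgroup.index_dvd_card _)
    exact ⟨a, ha⟩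
  · intro x y hx hy
    have hxq : (τ ^ q) x = x := Function.IsFixedPt.perm_pow hx q
    have hyq : (τ ^ q) y = y := Function.IsFixedPt.perm_pow hy q
    obtain ⟨g0, hg0, hg0x⟩ := ht x y hxq hyq
    have hT : {g : G | (β ^ q) g = g ∧ g • x = y} =
        (fun k => g0 * k) '' ((fixSub (β ^ q) ⊓ MulAction.stabilizer G x : Subgroup G) : Set G) := by
      ext g
      constructor
      · rintro ⟨h1, h2⟩
        refine ⟨g0⁻¹ * g, ⟨?_, ?_⟩, by simp⟩
        · exact (fixSub (β ^ q)).mul_mem ((fixSub (β ^ q)).inv_mem hg0) h1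
        · change (g0⁻¹ * g) • x = x
          rw [mul_smul, h2, ← hg0x, inv_smul_smul]
      · rintro ⟨k, ⟨h1, h2⟩, rfl⟩
        refine ⟨(fixSub (β ^ q)).mul_mem hg0 h1, ?_⟩
        change k • x = x at h2
        change (g0 * k) • x = y
        rw [mul_smul, h2, hg0x]
    obtain ⟨a, ha1, ha⟩ := exists_fixed {g : G | (β ^ q) g = g ∧ g • x = y} β.toEquiv q hq (by
      intro g
      simp only [Set.mem_ofPred_eq]
      change ((β ^ q) (β g) = β g ∧ β g • x = y) ↔ _
      rw [← MulAut.mul_apply, ← pow_succ, pow_succ', MulAut.mul_apply]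
      refine and_congr β.injective.eq_iff ?_
      have := h g x
      rw [hx] at this
      rw [← this]
      nth_rewrite 1 [← hy]
      exact τ.injective.eq_iff) (by
      intro g hg
      have : ∀ k : ℕ, ∀ g : G, ((β.toEquiv : Equiv.Perm G) ^ k) g = (β ^ k) g := by
        intro k
        induction k with
        | zero => intro g; rfl
        | succ k ih => intro g; rw [pow_succ, pow_succ, Equiv.Perm.mul_apply, ih]; rfl
      rw [this]
      exact hg.1) (by
      rw [hT, Nat.card_image_of_injective (mul_right_injective g0)]
      exact fun hd => hc (hd.trans (Subgroup.card_subgroup_dvd_card _)))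
    exact ⟨a, ha, ha1.2⟩

lemma glauberman {G X : Type*} [Group G] [Finite G] [Finite X] [Nonempty X] [MulAction G X]
    [MulAction.IsPretransitive G X]
    (α : MulAut G) (σ : Equiv.Perm X)
    (h : ∀ (g : G) (x : X), σ (g • x) = α g • σ x) (n : ℕ) (hn : n ≠ 0)
    (hα : α ^ n = 1) (hσ : σ ^ n = 1) (hc : n.Coprime (Nat.card G)) : ∃ x, σ x = x := by
  have key : ∀ k d : ℕ, d * k = n → (∃ x, (σ ^ d) x = x) ∧
      ∀ x y, (σ ^ d) x = x → (σ ^ d) y = y → ∃ g, (α ^ d) g = g ∧ g • x = y := by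
    intro k
    induction k using induction_on_primes with
    | zero => intro d hd; omega
    | one =>
      intro d hd
      rw [mul_one] at hd
      subst hd
      refine ⟨⟨Classical.arbitrary X, by rw [hσ]; rfl⟩, fun x y _ _ => ?_⟩
      obtain ⟨g, hg⟩ := MulAction.exists_smul_eq G x y
      exact ⟨g, by rw [hα]; rfl, hg⟩
    | prime_mul p a hp ih =>
      intro d hd
      obtain ⟨h1, h2⟩ := ih (d * p) (by rw [mul_assoc]; exact hd)
      rw [pow_mul] at h1
      simp only [pow_mul] at h2
      have hp' : p.Prime := hp
      refine glauberman_step (α ^ d) (σ ^ d) (compat_pow α σ h d) p hp' ?_ h1 h2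
      intro hpG
      have : p ∣ 1 := by
        rw [← hc]
        exact Nat.dvd_gcd ⟨d * a, by rw [← hd]; ring⟩ hpG
      exact hp'.one_lt.ne' (Nat.dvd_one.1 this)
  have := (key n 1 (one_mul n)).1
  simpa using this

open scoped Pointwise in
lemma exists_invariant_sylow {G : Type*} [Group G] [Finite G] (α : MulAut G)
    (hc : Nat.Coprime (orderOf α) (Nat.card G)) (p : ℕ) [Fact p.Prime] :
    ∃ P : Sylow p G, Subgroup.map α.toMonoidHom (P : Subgroup G) = P := by
  obtain ⟨P, hP⟩ := glauberman (X := Sylow p G) α (MulAction.toPermHom (MulAut G) (Sylow p G) α)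
    (by
      intro g P
      change α • (g • P) = α g • (α • P)
      rw [Sylow.smul_def, Sylow.smul_def, ← mul_smul, ← mul_smul]
      congr 1
      ext x
      simp) (orderOf α) (orderOf_pos α).ne' (pow_orderOf_eq_one α)
      (by rw [← map_pow, pow_orderOf_eq_one, map_one]) hc
  refine ⟨P, ?_⟩
  have h2 : α • P = P := hP
  have h3 := congrArg (fun Q : Sylow p G => (Q : Subgroup G)) h2
  exact h3

lemma le_of_prime_parts (n C : ℕ) (hn : n ≠ 0) (hC : 0 < C)
    (h : ∀ p, p.Prime → p ^ n.factorization p ≤ C) : n ≤ C ^ (C + 1) := by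
  have hsub : n.primeFactors ⊆ Finset.range (C + 1) := by
    intro p hp
    have hpp := Nat.prime_of_mem_primeFactors hp
    have h1 : 0 < n.factorization p :=
      hpp.factorization_pos_of_dvd hn (Nat.dvd_of_mem_primeFactors hp)
    have h2 := h p hpp
    have h3 : p ≤ p ^ n.factorization p := Nat.le_self_pow h1.ne' p
    simp only [Finset.mem_range]
    omega
  calc n = ∏ p ∈ n.primeFactors, p ^ n.factorization p := (Nat.prod_factorization_pow_eq_self hn).symm
    _ ≤ ∏ p ∈ n.primeFactors, C :=
        Finset.prod_le_prod' fun p hp => h p (Nat.prime_of_mem_primeFactors hp)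
    _ = C ^ n.primeFactors.card := by simp
    _ ≤ C ^ (C + 1) := by
        apply Nat.pow_le_pow_right hC
        simpa using Finset.card_le_card hsub

lemma index_fix_le {G : Type*} [Group G] [Finite G] (α : MulAut G) (C : ℕ) (hC : 0 < C)
    (hc : Nat.Coprime (orderOf α) (Nat.card G))
    (hS : ∀ (p : ℕ) [Fact p.Prime] (P : Sylow p G),
          Subgroup.map α.toMonoidHom (P : Subgroup G) = P →
          Nat.card (Subgroup.closure {x : G | ∃ g ∈ (P : Subgroup G), x = g⁻¹ * α g}) ≤ C) :
    (fixSub α).index ≤ C ^ (C + 1) := by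
  refine le_of_prime_parts _ C Subgroup.index_ne_zero_of_finite hC ?_
  intro p hp
  have : Fact p.Prime := ⟨hp⟩
  obtain ⟨P, hP⟩ := exists_invariant_sylow α hc p
  have hK := hS p P hP
  have hidx : ((fixSub α).subgroupOf (P : Subgroup G)).index ≤ C := by
    refine le_trans ?_ hK
    rw [Subgroup.index]
    refine Nat.card_le_card_of_injective (fun x =>
      ⟨(x.out : G) * (α (x.out : G))⁻¹, Subgroup.subset_closure
        ⟨(x.out : G)⁻¹, Subgroup.inv_mem _ x.out.2, by simp⟩⟩) ?_
    intro x y hxy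
    have e : (x.out : G) * (α (x.out : G))⁻¹ = (y.out : G) * (α (y.out : G))⁻¹ :=
      congrArg Subtype.val hxy
    rw [← x.out_eq', ← y.out_eq']
    rw [QuotientGroup.eq, Subgroup.mem_subgroupOf, mem_fixSub]
    simp only [Subgroup.coe_mul, Subgroup.coe_inv, map_mul, map_inv]
    have e2 : (α (x.out : G))⁻¹ = (x.out : G)⁻¹ * ((y.out : G) * (α (y.out : G))⁻¹) := by
      rw [← e]; group
    rw [e2]; group
  have hcard : Nat.card ((fixSub α).subgroupOf (P : Subgroup G)) *
      ((fixSub α).subgroupOf (P : Subgroup G)).index = p ^ (Nat.card G).factorization p := by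
    rw [Subgroup.card_mul_index, ← P.card_eq_multiplicity]
  have hQp : IsPGroup p ((fixSub α).subgroupOf (P : Subgroup G)) := P.isPGroup'.to_subgroup _
  obtain ⟨j, hj⟩ := IsPGroup.iff_card.1 hQp
  have hdvd : p ^ j ∣ Nat.card (fixSub α) := by
    rw [← hj]
    refine Subgroup.card_dvd_of_injective
      (((P : Subgroup G).subtype.comp ((fixSub α).subgroupOf (P : Subgroup G)).subtype).codRestrict
        (fixSub α) fun x => x.2) ?_
    intro a b hab
    have h1 : ((a : (P : Subgroup G)) : G) = ((b : (P : Subgroup G)) : G) :=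
      congrArg (fun z : fixSub α => (z : G)) hab
    exact Subtype.ext (Subtype.ext h1)
  have hj2 : j ≤ (Nat.card (fixSub α)).factorization p :=
    (hp.pow_dvd_iff_le_factorization Nat.card_pos.ne').1 hdvd
  have hG := Subgroup.card_mul_index (fixSub α)
  rw [← hG, Nat.factorization_mul Nat.card_pos.ne' Subgroup.index_ne_zero_of_finite,
    Finsupp.add_apply, pow_add, hj] at hcard
  have hpos : 0 < p ^ (Nat.card (fixSub α)).factorization p := pow_pos hp.pos _
  refine Nat.le_of_mul_le_mul_left ?_ hpos
  rw [← hcard]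
  exact Nat.mul_le_mul (Nat.pow_le_pow_right hp.pos hj2) hidx

lemma index_core_le {G : Type*} [Group G] [Finite G] (H : Subgroup G) :
    H.normalCore.index ≤ (H.index).factorial := by
  rw [Subgroup.normalCore_eq_ker, Subgroup.index_ker]
  refine (Subgroup.card_le_card_group _).trans ?_
  rw [Nat.card_perm]
  exact le_rfl

lemma core_le_center {G : Type*} [Group G] (α : MulAut G)
    (htop : Subgroup.closure {x : G | ∃ g : G, x = g⁻¹ * α g} = ⊤) :
    (fixSub α).normalCore ≤ Subgroup.center G := by
  intro n hn
  have h1 : Subgroup.closure {x : G | ∃ g : G, x = g⁻¹ * α g} ≤ Subgroup.centralizer {n} := by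
    rw [Subgroup.closure_le]
    rintro _ ⟨g, rfl⟩
    have hfix : α n = n := (fixSub α).normalCore_le hn
    have h2 : α (g * n * g⁻¹) = g * n * g⁻¹ := hn g
    simp only [map_mul, map_inv, hfix] at h2
    rw [SetLike.mem_coe, Subgroup.mem_centralizer_singleton_iff]
    have h3 : α g * n = g * n * g⁻¹ * α g := by rw [← h2]; group
    rw [mul_assoc, h3]; group
  rw [htop] at h1
  rw [Subgroup.mem_center_iff]
  intro g
  exact Subgroup.mem_centralizer_singleton_iff.1 (h1 (Subgroup.mem_top g))

lemma core_le_commutator {G : Type*} [Group G] [Finite G] (α : MulAut G)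
    (htop : Subgroup.closure {x : G | ∃ g : G, x = g⁻¹ * α g} = ⊤) :
    (fixSub α).normalCore ≤ commutator G := by
  let φ : Abelianization G →* Abelianization G :=
    (MonoidHom.id _)⁻¹ * Abelianization.map α.toMonoidHom
  have hφ : ∀ g : G, φ (Abelianization.of g) = Abelianization.of (g⁻¹ * α g) := by
    intro g
    simp [φ]
  have hsurj : Function.Surjective φ := by
    have h1 : Subgroup.closure {x : G | ∃ g : G, x = g⁻¹ * α g} ≤
        φ.range.comap Abelianization.of := by
      rw [Subgroup.closure_le]
      rintro _ ⟨g, rfl⟩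
      exact ⟨Abelianization.of g, hφ g⟩
    intro y
    obtain ⟨g, rfl⟩ := QuotientGroup.mk_surjective y
    rw [htop] at h1
    exact h1 (Subgroup.mem_top g)
  have : Finite (Abelianization G) := Quotient.finite _
  have hinj : Function.Injective φ := Finite.injective_iff_surjective.2 hsurj
  intro n hn
  have hfix : α n = n := (fixSub α).normalCore_le hn
  have h2 : φ (Abelianization.of n) = φ 1 := by
    rw [hφ, hfix]; simp
  have h3 := hinj h2
  rw [← Abelianization.ker_of]
  exact h3

open scoped commutatorElement in
lemma card_commutatorSet_le {G : Type*} [Group G] [Finite G] :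
    Nat.card (commutatorSet G) ≤ (Subgroup.center G).index * (Subgroup.center G).index := by
  rw [Subgroup.index, ← Nat.card_prod]
  refine Nat.card_le_card_of_surjective
    (fun x : (G ⧸ Subgroup.center G) × (G ⧸ Subgroup.center G) =>
      (⟨⁅x.1.out, x.2.out⁆, commutator_mem_commutatorSet _ _⟩ : commutatorSet G)) ?_
  rintro ⟨_, a, b, rfl⟩
  refine ⟨((a : G ⧸ Subgroup.center G), (b : G ⧸ Subgroup.center G)), Subtype.ext ?_⟩
  obtain ⟨⟨y, hy⟩, hy'⟩ := QuotientGroup.mk_out_eq_mul (Subgroup.center G) a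
  obtain ⟨⟨z, hz⟩, hz'⟩ := QuotientGroup.mk_out_eq_mul (Subgroup.center G) b
  simp only at hy' hz' ⊢
  rw [hy', hz']
  rw [Subgroup.mem_center_iff] at hy hz
  have hy2 := hy b
  simp only [commutatorElement_def, mul_inv_rev]
  calc a * y * (b * z) * (y⁻¹ * a⁻¹) * (z⁻¹ * b⁻¹)
      = a * (y * (b * z)) * (y⁻¹ * a⁻¹) * (z⁻¹ * b⁻¹) := by group
    _ = a * (b * z) * a⁻¹ * (z⁻¹ * b⁻¹) := by rw [← hy (b * z)]; group
    _ = a * b * (z * a⁻¹) * (z⁻¹ * b⁻¹) := by group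
    _ = a * b * a⁻¹ * b⁻¹ := by rw [← hz a⁻¹]; group

end CoprimeAut

open CoprimeAut in
/-- Lemma 2.4: There is `f : ℕ → ℕ` such that if a finite group `G` admits a coprime
automorphism `α` with `G = [G,α]`, and `|[P,α]| ≤ C` for every `α`-invariant Sylow
subgroup `P` of `G` (with `C ≥ 1`), then `|G| ≤ f C`. -/
theorem order_bounded_of_sylow_commutators_bounded :
    ∃ f : ℕ → ℕ,
      ∀ (G : Type*) [Group G] [Finite G] (α : MulAut G) (C : ℕ),
        0 < C →
        Nat.Coprime (orderOf α) (Nat.card G) →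
        Subgroup.closure {x : G | ∃ g : G, x = g⁻¹ * α g} = ⊤ →
        (∀ (p : ℕ) [Fact p.Prime] (P : Sylow p G),
          Subgroup.map α.toMonoidHom (P : Subgroup G) = P →
          Nat.card (Subgroup.closure {x : G | ∃ g ∈ (P : Subgroup G), x = g⁻¹ * α g}) ≤ C) →
        Nat.card G ≤ f C := by
  let M : ℕ → ℕ := fun C => (C ^ (C + 1)).factorial
  refine ⟨fun C => M C ^ (M C * (M C * M C) + 1) * M C, ?_⟩
  intro G _ _ α C hC hc htop hS
  have h1 : (fixSub α).normalCore.index ≤ M C :=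
    (index_core_le _).trans (Nat.factorial_le (index_fix_le α C hC hc hS))
  have h2 : (Subgroup.center G).index ≤ M C :=
    (Nat.le_of_dvd (Nat.pos_of_ne_zero Subgroup.index_ne_zero_of_finite)
      (Subgroup.index_dvd_of_le (core_le_center α htop))).trans h1
  have hM : 0 < M C := Nat.factorial_pos _
  have hpos : 0 < (Subgroup.center G).index :=
    Nat.pos_of_ne_zero Subgroup.index_ne_zero_of_finite
  have h3 : Nat.card (commutator G) ≤ M C ^ (M C * (M C * M C) + 1) := by
    refine (Nat.le_of_dvd (pow_pos hpos _)
      (Subgroup.card_commutator_dvd_index_center_pow G)).trans ?_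
    refine (Nat.pow_le_pow_left h2 _).trans (Nat.pow_le_pow_right hM ?_)
    exact Nat.succ_le_succ (Nat.mul_le_mul h2
      (card_commutatorSet_le.trans (Nat.mul_le_mul h2 h2)))
  have h4 : Nat.card (fixSub α).normalCore ≤ Nat.card (commutator G) :=
    Subgroup.card_le_of_le (core_le_commutator α htop)
  rw [← Subgroup.card_mul_index (fixSub α).normalCore]
  exact Nat.mul_le_mul (h4.trans h3) h1
end

section
/- There exists a function f : ℕ → ℕ such that the following holds. Let G be a finite group with a normal subgroup H and an element a ∈ G such that G = H⟨a⟩, gcd(|H|, ord(a)) = 1, and H = [H,a], where [H,a] is the subgroup generated by {h⁻¹·a⁻¹·h·a : h ∈ H}. Suppose that G acts faithfully by permutations on a finite set Ω and that a moves at most m points of Ω (i.e., |{ω ∈ Ω : a·ω ≠ ω}| ≤ m). Then |G| ≤ f(m). -/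
theorem quot_commute {G : Type*} [Group G] (H : Subgroup G) [H.Normal] (a : G)
    (hG : H ⊔ Subgroup.zpowers a = ⊤) (g : G) : a * (g * a * g⁻¹)⁻¹ ∈ H := by
  have h1 : H ⊔ Subgroup.zpowers a ≤
      (Subgroup.centralizer {QuotientGroup.mk' H a}).comap (QuotientGroup.mk' H) := by
    refine sup_le ?_ ?_
    · intro h hh
      have : QuotientGroup.mk' H h = 1 := (QuotientGroup.eq_one_iff h).2 hh
      rw [Subgroup.mem_comap, this]
      exact one_mem _
    · rw [Subgroup.zpowers_le, Subgroup.mem_comap, Subgroup.mem_centralizer_singleton_iff]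
  rw [hG] at h1
  have h2 := h1 (Subgroup.mem_top g)
  rw [Subgroup.mem_comap, Subgroup.mem_centralizer_singleton_iff] at h2
  rw [← QuotientGroup.eq_one_iff]
  change QuotientGroup.mk' H (a * (g * a * g⁻¹)⁻¹) = 1
  rw [map_mul, map_inv, map_mul, map_mul, map_inv, h2]
  group

theorem supports_meet {G : Type*} [Group G] [Finite G] (H : Subgroup G) [H.Normal] (a : G)
    (hG : H ⊔ Subgroup.zpowers a = ⊤) (hc : Nat.Coprime (Nat.card H) (orderOf a))
    {X : Type*} [MulAction G X] {x : X} (hx : a • x ≠ x) (g : G) :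
    ∃ y : X, a • y ≠ y ∧ a • (g⁻¹ • y) ≠ g⁻¹ • y := by
  by_contra! hcon
  let φ := MulAction.toPermHom G X
  have hd : Equiv.Perm.Disjoint (φ a) (φ (g * a * g⁻¹)) := by
    intro y
    by_cases hy : a • y = y
    · exact Or.inl hy
    · right
      change (g * a * g⁻¹) • y = y
      rw [mul_smul, mul_smul, hcon y hy, smul_inv_smul]
  have hcomm := hd.commute
  have h0 := quot_commute H a hG g
  have h1 : φ (a * (g * a * g⁻¹)⁻¹) ^ orderOf a = 1 := by
    rw [map_mul, map_inv, (hcomm.inv_right).mul_pow, inv_pow, ← map_pow, ← map_pow, conj_pow,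
      pow_orderOf_eq_one]
    simp
  have h2 : φ (a * (g * a * g⁻¹)⁻¹) ^ Nat.card H = 1 := by
    have h4 : (⟨_, h0⟩ : H) ^ Nat.card H = 1 := pow_card_eq_one'
    have h5 : (a * (g * a * g⁻¹)⁻¹) ^ Nat.card H = 1 := congrArg Subtype.val h4
    rw [← map_pow, h5, map_one]
  have h3 : φ (a * (g * a * g⁻¹)⁻¹) = 1 := by
    rw [← orderOf_eq_one_iff]
    exact Nat.eq_one_of_dvd_coprimes hc (orderOf_dvd_of_pow_eq_one h2)
      (orderOf_dvd_of_pow_eq_one h1)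
  rw [map_mul, map_inv, mul_inv_eq_one] at h3
  rw [← h3, Equiv.Perm.disjoint_refl_iff] at hd
  exact hx (congrArg (fun e : Equiv.Perm X => e x) hd)

theorem card_transitive {G : Type*} [Group G] [Finite G] (H : Subgroup G) [H.Normal] (a : G)
    (hG : H ⊔ Subgroup.zpowers a = ⊤) (hc : Nat.Coprime (Nat.card H) (orderOf a))
    {X : Type*} [Finite X] [MulAction G X] [MulAction.IsPretransitive G X]
    {x : X} (hx : a • x ≠ x) :
    Nat.card X ≤ Nat.card {y : X | a • y ≠ y} * Nat.card {y : X | a • y ≠ y} := by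
  choose y hy hz using supports_meet H a hG hc hx
  choose c hcx using fun z : X => MulAction.exists_smul_eq G x z
  let F : G → ({y : X | a • y ≠ y} × {y : X | a • y ≠ y}) × MulAction.stabilizer G x :=
    fun g => ((⟨y g, hy g⟩, ⟨g⁻¹ • y g, hz g⟩),
      ⟨(c (y g))⁻¹ * g * c (g⁻¹ • y g), by
        rw [MulAction.mem_stabilizer_iff, mul_smul, mul_smul, hcx, smul_inv_smul,
          inv_smul_eq_iff, hcx]⟩)
  have hF : Function.Injective F := by
    intro g g' h
    simp only [F, Prod.mk.injEq, Subtype.mk.injEq] at h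
    obtain ⟨⟨h1, h2⟩, h3⟩ := h
    rw [h2, h1] at h3
    simpa using h3
  have h1 := Nat.card_le_card_of_injective F hF
  rw [Nat.card_prod, Nat.card_prod] at h1
  have h2 := MulAction.index_stabilizer_of_transitive G x
  have h3 := (MulAction.stabilizer G x).index_mul_card
  rw [h2] at h3
  rw [← h3] at h1
  exact Nat.le_of_mul_le_mul_right h1 Nat.card_pos

theorem card_orbit_le {G : Type*} [Group G] [Finite G] (H : Subgroup G) [H.Normal] (a : G)
    (hG : H ⊔ Subgroup.zpowers a = ⊤) (hc : Nat.Coprime (Nat.card H) (orderOf a))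
    {Ω : Type*} [Finite Ω] [MulAction G Ω] {w : Ω} (hw : a • w ≠ w) :
    Nat.card (MulAction.orbit G w) ≤
      Nat.card {y : Ω | a • y ≠ y} * Nat.card {y : Ω | a • y ≠ y} := by
  have h1 := card_transitive H a hG hc (X := MulAction.orbit G w)
    (x := ⟨w, MulAction.mem_orbit_self w⟩) (fun h => hw (congrArg Subtype.val h))
  have h2 : Nat.card {y : MulAction.orbit G w | a • y ≠ y} ≤ Nat.card {y : Ω | a • y ≠ y} := by
    refine Nat.card_le_card_of_injective
      (fun y => ⟨y.1.1, fun h => y.2 (Subtype.ext h)⟩) ?_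
    intro y z h
    have hyz : (y.1.1 : Ω) = z.1.1 := by simpa using h
    exact Subtype.ext (Subtype.ext hyz)
  exact h1.trans (Nat.mul_le_mul h2 h2)

/-- If `a` acts trivially on an orbit then so does `G`. -/
theorem moved_mem_orbit {G : Type*} [Group G] (H : Subgroup G) (a : G)
    (hG : H ⊔ Subgroup.zpowers a = ⊤)
    (hH : H = Subgroup.closure {x : G | ∃ h ∈ H, x = h⁻¹ * a⁻¹ * h * a})
    {Ω : Type*} [MulAction G Ω] {w : Ω} {g : G} (hg : g • w ≠ w) :
    ∃ v : Ω, a • v ≠ v ∧ w ∈ MulAction.orbit G v := by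
  by_contra! hcon
  have hfix : ∀ k : G, a • (k • w) = k • w := by
    intro k
    by_contra h
    exact hcon _ h ((MulAction.mem_orbit_symm).1 (MulAction.mem_orbit w k))
  have ha : a • w = w := by simpa using hfix 1
  have h1 : H ≤ MulAction.stabilizer G w := by
    rw [hH, Subgroup.closure_le]
    rintro _ ⟨h, -, rfl⟩
    change (h⁻¹ * a⁻¹ * h * a) • w = w
    rw [mul_smul, mul_smul, mul_smul, ha, inv_smul_eq_iff, inv_smul_eq_iff, hfix]
  have h2 : H ⊔ Subgroup.zpowers a ≤ MulAction.stabilizer G w :=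
    sup_le h1 (by rw [Subgroup.zpowers_le]; exact ha)
  rw [hG] at h2
  exact hg (h2 (Subgroup.mem_top g))

theorem card_le_factorial {G : Type*} [Group G] [Finite G] {Ω : Type*} [Finite Ω]
    [MulAction G Ω] [FaithfulSMul G Ω] :
    Nat.card G ≤ (Nat.card {w : Ω | ∃ g : G, g • w ≠ w}).factorial := by
  classical
  rw [← Nat.card_perm]
  have hinv : ∀ (g : G) (w : Ω), (∃ k : G, k • w ≠ w) ↔ (∃ k : G, k • (g • w) ≠ g • w) := by
    intro g w
    constructor
    · rintro ⟨k, hk⟩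
      refine ⟨g * k * g⁻¹, ?_⟩
      rwa [mul_smul, inv_smul_smul, mul_smul, ne_eq, smul_left_cancel_iff]
    · rintro ⟨k, hk⟩
      refine ⟨g⁻¹ * k * g, ?_⟩
      rwa [mul_smul, mul_smul, ne_eq, inv_smul_eq_iff]
  refine Nat.card_le_card_of_injective
    (fun g : G => (MulAction.toPerm g : Equiv.Perm Ω).subtypePerm (fun w => (hinv g w).symm)) ?_
  intro g g' h
  apply FaithfulSMul.eq_of_smul_eq_smul (α := Ω)
  intro w
  by_cases hw : ∃ k : G, k • w ≠ w
  · exact congrArg Subtype.val (congrArg (fun e => e ⟨w, hw⟩) h)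
  · push Not at hw
    rw [hw, hw]

/-- Lemma 2.5: There is `f : ℕ → ℕ` such that if `G = H⟨a⟩` is a finite group with a normal
subgroup `H` and an element `a` with `gcd(|H|, ord(a)) = 1` and `H = [H,a]`, and `G` acts
faithfully by permutations on a finite set `Ω` on which `a` moves at most `m` points, then
`|G| ≤ f m`. -/
theorem order_bounded_of_moved_points :
    ∃ f : ℕ → ℕ,
      ∀ (G : Type*) [Group G] [Finite G] (H : Subgroup G) (_ : H.Normal) (a : G)
        (Ω : Type*) [Finite Ω] [MulAction G Ω] [FaithfulSMul G Ω] (m : ℕ),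
        H ⊔ Subgroup.zpowers a = ⊤ →
        Nat.Coprime (Nat.card H) (orderOf a) →
        H = Subgroup.closure {x : G | ∃ h ∈ H, x = h⁻¹ * a⁻¹ * h * a} →
        Nat.card {ω : Ω | a • ω ≠ ω} ≤ m →
        Nat.card G ≤ f m := by
  refine ⟨fun m => (m * (m * m)).factorial, ?_⟩
  intro G _ _ H _ a Ω _ _ _ m hG hc hH hm
  refine (card_le_factorial (G := G) (Ω := Ω)).trans (Nat.factorial_le ?_)
  have hsub : {w : Ω | ∃ g : G, g • w ≠ w} ⊆
      ⋃ v : {v : Ω | a • v ≠ v}, MulAction.orbit G (v : Ω) := by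
    rintro w ⟨g, hg⟩
    obtain ⟨v, hv, hw⟩ := moved_mem_orbit H a hG hH hg
    exact Set.mem_iUnion.2 ⟨⟨v, hv⟩, hw⟩
  classical
  have : Fintype {v : Ω | a • v ≠ v} := Fintype.ofFinite _
  calc Nat.card {w : Ω | ∃ g : G, g • w ≠ w}
      ≤ (⋃ v : {v : Ω | a • v ≠ v}, MulAction.orbit G (v : Ω)).ncard :=
        Set.ncard_le_ncard hsub (Set.toFinite _)
    _ ≤ ∑ v : {v : Ω | a • v ≠ v}, (MulAction.orbit G (v : Ω)).ncard :=
        Set.ncard_iUnion_le_of_fintype _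
    _ ≤ ∑ _v : {v : Ω | a • v ≠ v}, m * m :=
        Finset.sum_le_sum fun v _ =>
          (card_orbit_le H a hG hc v.2).trans (Nat.mul_le_mul hm hm)
    _ ≤ m * (m * m) := by
        rw [Finset.sum_const, Finset.card_univ, smul_eq_mul, ← Nat.card_eq_fintype_card]
        exact Nat.mul_le_mul_right _ hm
end

section
/- Let e ≥ 5 be an odd positive integer, q₀ an odd prime power, and q = q₀^e. Let F be the finite field with q elements, let H = PSL₂(F) be the quotient of SL₂(F) by its center, and let α be the automorphism of H induced by the field automorphism x ↦ x^{q₀} of F (applied entrywise to matrices); α is a field automorphism of H of order e. Then for every y ∈ H there exist g, h ∈ H such that y = g⁻¹ · α(g·h⁻¹) · h. Equivalently, if C denotes the conjugacy class of α in the extension H⟨α⟩, then C·C⁻¹ = H. -/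
theorem aux_iso {K V : Type*} [Field K] [Finite K] [AddCommGroup V] [Module K V]
    [FiniteDimensional K V] (B : V →ₗ[K] V →ₗ[K] K) (h : 3 ≤ Module.finrank K V) :
    ∃ v : V, v ≠ 0 ∧ B v v = 0 := by
  classical
  have := Fintype.ofFinite K
  obtain ⟨p, hp⟩ := CharP.exists K
  have : Fact p.Prime := ⟨CharP.char_is_prime K p⟩
  let b := Module.finBasis K V
  let f : MvPolynomial (Fin (Module.finrank K V)) K :=
    ∑ i, ∑ j, MvPolynomial.C (B (b i) (b j)) * (MvPolynomial.X i * MvPolynomial.X j)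
  have hdeg : f.totalDegree ≤ 2 := by
    refine MvPolynomial.totalDegree_finsetSum_le fun i _ => ?_
    refine MvPolynomial.totalDegree_finsetSum_le fun j _ => ?_
    refine (MvPolynomial.totalDegree_mul _ _).trans ?_
    have := MvPolynomial.totalDegree_mul (R := K)
      (MvPolynomial.X i) (MvPolynomial.X j)
    simp only [MvPolynomial.totalDegree_C, MvPolynomial.totalDegree_X] at *
    omega
  have hev : ∀ x : Fin (Module.finrank K V) → K,
      MvPolynomial.eval x f = B (∑ i, x i • b i) (∑ i, x i • b i) := by
    intro x
    simp only [f, map_sum, LinearMap.sum_apply, map_smul, LinearMap.smul_apply, smul_eq_mul,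
      MvPolynomial.eval_mul, MvPolynomial.eval_C, MvPolynomial.eval_X]
    rw [Finset.sum_comm]
    refine Finset.sum_congr rfl fun i _ => ?_
    rw [Finset.mul_sum]
    exact Finset.sum_congr rfl fun j _ => by ring
  have hcw := char_dvd_card_solutions (f := f) p (by simpa using by omega)
  have h0 : MvPolynomial.eval (0 : Fin (Module.finrank K V) → K) f = 0 := by
    rw [hev]; simp
  have hpos : 0 < Fintype.card {x : Fin (Module.finrank K V) → K // MvPolynomial.eval x f = 0} :=
    Fintype.card_pos_iff.mpr ⟨⟨0, h0⟩⟩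
  have h1 : 1 < Fintype.card {x : Fin (Module.finrank K V) → K // MvPolynomial.eval x f = 0} :=
    lt_of_lt_of_le (Fact.out : p.Prime).one_lt (Nat.le_of_dvd hpos hcw)
  obtain ⟨⟨x, hx⟩, hne⟩ := Fintype.exists_ne_of_one_lt_card h1 ⟨0, h0⟩
  refine ⟨∑ i, x i • b i, ?_, by rw [← hev]; exact hx⟩
  intro hz
  apply hne
  have := Fintype.linearIndependent_iff.mp b.linearIndependent x hz
  exact Subtype.ext (funext this)

/-- analytic core: solvability of the quadratic equation. -/
theorem aux_core {F : Type*} [Field F] [Fintype F] (e q₀ : ℕ) (he5 : 5 ≤ e) (hq : 1 < q₀)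
    (hF : Fintype.card F = q₀ ^ e) (σ : F ≃+* F) (hσ : ∀ x : F, σ x = x ^ q₀) :
    (∃ r : F, σ r - r ≠ 0) ∧ ∀ r t : F, σ r - r ≠ 0 → ∃ c x : F, c ≠ 0 ∧
      (t * c * σ c - c ^ 2 - σ c ^ 2) / (σ r - r) = σ x - x := by
  classical
  let K : Subfield F := RingHom.eqLocusField (σ : F →+* F) (RingHom.id F)
  have hK : ∀ x : F, x ∈ K ↔ σ x = x := fun x => Iff.rfl
  have : Fintype K := Fintype.ofFinite K
  have hcardK : Fintype.card K ≤ q₀ := by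
    let P : Polynomial F := Polynomial.X ^ q₀ - Polynomial.X
    have hP : P ≠ 0 := FiniteField.X_pow_card_sub_X_ne_zero F hq
    have hd : P.natDegree = q₀ := FiniteField.X_pow_card_sub_X_natDegree_eq F hq
    have : Fintype.card K ≤ P.roots.toFinset.card := by
      rw [← Finset.card_univ, ← Finset.card_map (Function.Embedding.subtype _)]
      refine Finset.card_le_card fun x hx => ?_
      simp only [Finset.mem_map, Finset.mem_univ, true_and] at hx
      obtain ⟨y, rfl⟩ := hx
      have hy := (hK _).1 y.2
      rw [hσ] at hy
      simp [P, hP, hy]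
    calc _ ≤ _ := this
      _ ≤ _ := Multiset.toFinset_card_le _
      _ ≤ _ := P.card_roots'
      _ = q₀ := hd
  have hn : e ≤ Module.finrank K F := by
    have h1 := Module.card_eq_pow_finrank (K := K) (V := F)
    rw [hF] at h1
    have : q₀ ^ e ≤ q₀ ^ Module.finrank K F := h1 ▸ Nat.pow_le_pow_left hcardK _
    exact (Nat.pow_le_pow_iff_right hq).1 this
  let s : F →ₗ[K] F :=
    { toFun := σ, map_add' := map_add σ,
      map_smul' := fun a x => by
        have := (hK _).1 a.2
        simp [Subfield.smul_def, this] }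
  have hs : ∀ x, s x = σ x := fun _ => rfl
  let D : F →ₗ[K] F := s - LinearMap.id
  have hD : ∀ x, D x = σ x - x := fun _ => rfl
  have hker : Module.finrank K (LinearMap.ker D) ≤ 1 := by
    refine finrank_le_one ⟨1, by simp [hD]⟩ ?_
    rintro ⟨x, hx⟩
    rw [LinearMap.mem_ker, hD, sub_eq_zero] at hx
    exact ⟨⟨x, (hK x).2 hx⟩, Subtype.ext (by simp [Subfield.smul_def])⟩
  have hrk := LinearMap.finrank_range_add_finrank_ker D
  have hone : Module.finrank K (LinearMap.ker D) = 1 := by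
    refine le_antisymm hker (Nat.one_le_iff_ne_zero.2 ?_)
    intro h0
    rw [Submodule.finrank_eq_zero] at h0
    have : (1 : F) ∈ LinearMap.ker D := by simp [hD]
    rw [h0] at this
    simp at this
  have hlt : LinearMap.range D < ⊤ := by
    rw [lt_top_iff_ne_top]
    intro h
    rw [h, finrank_top] at hrk
    omega
  obtain ⟨φ, hφ0, hφ⟩ := Submodule.exists_le_ker_of_lt_top _ hlt
  have hφr : LinearMap.range D = LinearMap.ker φ := by
    apply Submodule.eq_of_le_of_finrank_le hφ
    have h1 := LinearMap.finrank_range_add_finrank_ker φ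
    have h2 : Module.finrank K (LinearMap.range φ) ≠ 0 := by
      rw [Ne, Submodule.finrank_eq_zero, LinearMap.range_eq_bot]
      exact hφ0
    omega
  constructor
  · by_contra! hc
    have : LinearMap.ker D = ⊤ := by
      rw [eq_top_iff]; intro x _; exact hc x
    rw [this, finrank_top] at hone
    omega
  · intro r t hr
    let B : F →ₗ[K] F →ₗ[K] K := LinearMap.mk₂ K
      (fun c d => φ ((t * c * s d - c * d - s c * s d) / (σ r - r)))
      (fun a b c => by rw [← map_add]; congr 1; rw [map_add]; ring)
      (fun a b c => by
        rw [← map_smul]; congr 1; rw [map_smul]; simp only [Subfield.smul_def, smul_eq_mul]; ring)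
      (fun a b c => by rw [← map_add]; congr 1; rw [map_add]; ring)
      (fun a b c => by
        rw [← map_smul]; congr 1; rw [map_smul]; simp only [Subfield.smul_def, smul_eq_mul]; ring)
    obtain ⟨c, hc, hB⟩ := aux_iso B (by omega)
    have : (t * c * s c - c * c - s c * s c) / (σ r - r) ∈ LinearMap.range D := by
      rw [hφr]; exact hB
    obtain ⟨x, hx⟩ := this
    refine ⟨c, x, hc, ?_⟩
    rw [← hD x, hx, hs]; ring

theorem aux_nonsq {F : Type*} [Field F] [Fintype F] (e q₀ : ℕ) (he : Odd e) (hq : Odd q₀)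
    (hF : Fintype.card F = q₀ ^ e) (σ : F ≃+* F) (hσ : ∀ x : F, σ x = x ^ q₀) :
    ∃ ν : F, ¬ IsSquare ν ∧ σ ν = ν := by
  have hodd : Odd (Fintype.card F) := hF ▸ hq.pow
  have hchar : ringChar F ≠ 2 := by
    intro h
    have := FiniteField.even_card_of_char_two h
    rw [Nat.odd_iff] at hodd
    omega
  obtain ⟨n, hn⟩ := FiniteField.exists_nonsquare hchar
  have hn0 : n ≠ 0 := by rintro rfl; exact hn (IsSquare.zero)
  let S := ∑ i ∈ Finset.range e, q₀ ^ i
  have hS : Odd S := by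
    rw [Finset.odd_sum_iff_odd_card_odd]
    simpa [hq.pow] using he
  have hSq : S * q₀ + 1 = S + q₀ ^ e := by
    simp only [S]
    rw [← Finset.sum_range_succ, Finset.sum_range_succ', Finset.sum_mul]
    simp [pow_succ]
  refine ⟨n ^ S, ?_, ?_⟩
  · obtain ⟨m, hm⟩ := hS
    rintro ⟨a, ha⟩
    apply hn
    refine ⟨a / n ^ m, ?_⟩
    rw [hm] at ha
    field_simp
    rw [pow_two a, ← ha]; ring
  · rw [hσ, ← pow_mul]
    have : n ^ (S * q₀ + 1) = n ^ (S + q₀ ^ e) := by rw [hSq]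
    rw [pow_add, pow_add, ← hF, FiniteField.pow_card, pow_one] at this
    exact mul_right_cancel₀ hn0 this

abbrev SL2 (F : Type*) [Field F] := Matrix.SpecialLinearGroup (Fin 2) F

def Good {F : Type*} [Field F] (σ : F ≃+* F) (A : SL2 F) : Prop :=
  ∃ h k : SL2 F, A = h⁻¹ * (k⁻¹ * Matrix.SpecialLinearGroup.map (σ : F →+* F) k) * h

theorem Good.conj {F : Type*} [Field F] {σ : F ≃+* F} {A B S : SL2 F} (hA : Good σ A)
    (h : A * S = S * B) : Good σ B := by
  obtain ⟨x, k, hx⟩ := hA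
  refine ⟨x * S, k, ?_⟩
  have : B = S⁻¹ * A * S := by rw [mul_assoc, h]; group
  rw [this, hx]; group

theorem aux_det {F : Type*} [Field F] (A : SL2 F) : A 0 0 * A 1 1 - A 0 1 * A 1 0 = 1 := by
  have := A.2
  rwa [Matrix.det_fin_two] at this

def mk2 {F : Type*} [Field F] (a b c d : F) (h : a * d - b * c = 1) : SL2 F :=
  ⟨!![a, b; c, d], by rw [Matrix.det_fin_two_of]; exact h⟩

section entries
variable {F : Type*} [Field F]

theorem mk2_00 (a b c d : F) (h : a * d - b * c = 1) : (mk2 a b c d h) 0 0 = a := rfl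
theorem mk2_01 (a b c d : F) (h : a * d - b * c = 1) : (mk2 a b c d h) 0 1 = b := rfl
theorem mk2_10 (a b c d : F) (h : a * d - b * c = 1) : (mk2 a b c d h) 1 0 = c := rfl
theorem mk2_11 (a b c d : F) (h : a * d - b * c = 1) : (mk2 a b c d h) 1 1 = d := rfl

theorem sl_mul (A B : SL2 F) (i j : Fin 2) :
    (A * B) i j = A i 0 * B 0 j + A i 1 * B 1 j := by
  rw [Matrix.SpecialLinearGroup.coe_mul, Matrix.mul_apply, Fin.sum_univ_two]

theorem sl_map (σ : F ≃+* F) (A : SL2 F) (i j : Fin 2) :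
    (Matrix.SpecialLinearGroup.map (σ : F →+* F) A) i j = σ (A i j) := rfl

theorem sl_inv (A : SL2 F) : (A⁻¹) 0 0 = A 1 1 ∧ (A⁻¹) 0 1 = -A 0 1 ∧
    (A⁻¹) 1 0 = -A 1 0 ∧ (A⁻¹) 1 1 = A 0 0 := by
  rw [Matrix.SpecialLinearGroup.coe_inv, Matrix.adjugate_fin_two]
  exact ⟨rfl, rfl, rfl, rfl⟩

theorem sl_ext {A B : SL2 F} (h00 : A 0 0 = B 0 0) (h01 : A 0 1 = B 0 1)
    (h10 : A 1 0 = B 1 0) (h11 : A 1 1 = B 1 1) : A = B := by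
  ext i j
  fin_cases i <;> fin_cases j
  · exact h00
  · exact h01
  · exact h10
  · exact h11

end entries

/-- conjugation by `diag(1, ν)`. -/
def th {F : Type*} [Field F] (ν : F) (hν : ν ≠ 0) : SL2 F →* SL2 F where
  toFun A := mk2 (A 0 0) (ν⁻¹ * A 0 1) (ν * A 1 0) (A 1 1) (by
    have := aux_det A
    have h2 : ν⁻¹ * ν = 1 := inv_mul_cancel₀ hν
    linear_combination this - A 0 1 * A 1 0 * h2)
  map_one' := by
    apply sl_ext <;> simp [mk2_00, mk2_01, mk2_10, mk2_11]
  map_mul' A B := by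
    apply sl_ext <;> simp only [mk2_00, mk2_01, mk2_10, mk2_11, sl_mul] <;> field_simp

section entries
variable {F : Type*} [Field F] (ν : F) (hν : ν ≠ 0) (A : SL2 F)
theorem th_00 : (th ν hν A) 0 0 = A 0 0 := rfl
theorem th_01 : (th ν hν A) 0 1 = ν⁻¹ * A 0 1 := rfl
theorem th_10 : (th ν hν A) 1 0 = ν * A 1 0 := rfl
theorem th_11 : (th ν hν A) 1 1 = A 1 1 := rfl
end entries

def DD {F : Type*} [Field F] (δ t : F) (hδ : δ ≠ 0) : SL2 F :=
  mk2 0 (-δ⁻¹) δ t (by field_simp; ring)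

theorem Good.th {F : Type*} [Field F] {σ : F ≃+* F} {A : SL2 F} (hA : Good σ A) (ν : F)
    (hν : ν ≠ 0) (hs : σ ν = ν) : Good σ (th ν hν A) := by
  obtain ⟨x, k, hx⟩ := hA
  refine ⟨_root_.th ν hν x, _root_.th ν hν k, ?_⟩
  rw [hx]
  simp only [map_mul, map_inv]
  congr 3
  apply sl_ext <;> simp only [th_00, th_01, th_10, th_11, sl_map, map_mul, map_inv₀, hs]

theorem aux_DD {F : Type*} [Field F] (A : SL2 F) (v w : F)
    (δ : F) (hδ : δ ≠ 0)
    (hd : δ = v * (A 1 0 * v + A 1 1 * w) - w * (A 0 0 * v + A 0 1 * w)) :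
    ∃ S : SL2 F, A * S = S * DD δ (A 0 0 + A 1 1) hδ := by
  have hA := aux_det A
  refine ⟨mk2 v ((A 0 0 * v + A 0 1 * w) / δ) w ((A 1 0 * v + A 1 1 * w) / δ) ?_, ?_⟩
  · field_simp
    rw [hd]
    ring
  · apply sl_ext <;> simp only [DD, mk2_00, mk2_01, mk2_10, mk2_11, sl_mul] <;> field_simp
    · ring
    · linear_combination (-v) * hA
    · ring
    · linear_combination (-w) * hA

theorem aux_DD' {F : Type*} [Field F] (A : SL2 F)
    (h : ¬ (A 0 1 = 0 ∧ A 1 0 = 0 ∧ A 0 0 = A 1 1)) :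
    ∃ (δ : F) (hδ : δ ≠ 0) (S : SL2 F), A * S = S * DD δ (A 0 0 + A 1 1) hδ := by
  by_cases h1 : A 1 0 = 0
  · by_cases h2 : A 0 1 = 0
    · have h3 : A 1 1 - A 0 0 ≠ 0 := fun h3 => h ⟨h2, h1, (sub_eq_zero.1 h3).symm⟩
      exact ⟨_, h3, aux_DD A 1 1 _ h3 (by rw [h1, h2]; ring)⟩
    · exact ⟨_, neg_ne_zero.2 h2, aux_DD A 0 1 _ (neg_ne_zero.2 h2) (by ring)⟩
  · exact ⟨_, h1, aux_DD A 1 0 _ h1 (by ring)⟩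

theorem Good.sq {F : Type*} [Field F] {σ : F ≃+* F} {δ t μ : F} {hδ : δ ≠ 0}
    (h : Good σ (DD δ t hδ)) (hμ : μ ≠ 0) (δ' : F) (hδ' : δ' ≠ 0) (e : δ' = μ * μ * δ) :
    Good σ (DD δ' t hδ') := by
  subst e
  refine h.conj (S := mk2 μ 0 0 μ⁻¹ (by field_simp; ring)) ?_
  apply sl_ext <;> simp only [DD, mk2_00, mk2_01, mk2_10, mk2_11, sl_mul] <;> field_simp <;> ring

theorem Good.all {F : Type*} [Field F] [Fintype F] {σ : F ≃+* F} {ν : F} (hν : ¬ IsSquare ν)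
    (hs : σ ν = ν) {δ t : F} {hδ : δ ≠ 0}
    (h : Good σ (DD δ t hδ)) (δ' : F) (hδ' : δ' ≠ 0) : Good σ (DD δ' t hδ') := by
  classical
  have hν0 : ν ≠ 0 := by rintro rfl; exact hν IsSquare.zero
  by_cases hq : IsSquare (δ' / δ)
  · obtain ⟨μ, hμ⟩ := hq
    have hμ0 : μ ≠ 0 := by
      rintro rfl
      rw [mul_zero] at hμ
      exact div_ne_zero hδ' hδ hμ
    exact h.sq hμ0 δ' hδ' (by rw [← hμ]; field_simp)
  · have hsq : IsSquare (δ' / δ * ν) := by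
      rw [← quadraticChar_one_iff_isSquare (by positivity), map_mul,
        quadraticChar_neg_one_iff_not_isSquare.2 hq,
        quadraticChar_neg_one_iff_not_isSquare.2 hν]
      norm_num
    obtain ⟨μ, hμ⟩ := hsq
    have hμ0 : μ ≠ 0 := by
      rintro rfl
      rw [mul_zero] at hμ
      exact mul_ne_zero (div_ne_zero hδ' hδ) hν0 hμ
    have h2 := h.th ν hν0 hs
    have h3 : _root_.th ν hν0 (DD δ t hδ) = DD (ν * δ) t (mul_ne_zero hν0 hδ) := by
      apply sl_ext <;>
        simp only [DD, mk2_00, mk2_01, mk2_10, mk2_11, th_00, th_01, th_10, th_11] <;> field_simp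
    rw [h3] at h2
    refine h2.sq (div_ne_zero hμ0 hν0) δ' hδ' ?_
    field_simp
    rw [pow_two, ← hμ]
    field_simp

theorem Good.trace {F : Type*} [Field F] [Fintype F] {σ : F ≃+* F} {ν : F} (hν : ¬ IsSquare ν)
    (hs : σ ν = ν) {A B : SL2 F} (hA : Good σ A)
    (hA' : ¬ (A 0 1 = 0 ∧ A 1 0 = 0 ∧ A 0 0 = A 1 1))
    (hB' : ¬ (B 0 1 = 0 ∧ B 1 0 = 0 ∧ B 0 0 = B 1 1))
    (ht : A 0 0 + A 1 1 = B 0 0 + B 1 1) : Good σ B := by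
  obtain ⟨δ, hδ, S, hS⟩ := aux_DD' A hA'
  obtain ⟨δ', hδ', S', hS'⟩ := aux_DD' B hB'
  have h1 := (hA.conj hS).all hν hs δ' hδ'
  rw [ht] at h1
  refine h1.conj (S := S'⁻¹) ?_
  rw [eq_inv_mul_iff_mul_eq, ← mul_assoc, ← hS']
  group

theorem aux_good {F : Type*} [Field F] [Fintype F] (e q₀ : ℕ) (he : Odd e) (hq : Odd q₀)
    (hq1 : 1 < q₀) (he5 : 5 ≤ e)
    (hF : Fintype.card F = q₀ ^ e) (σ : F ≃+* F) (hσ : ∀ x : F, σ x = x ^ q₀)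
    (B : SL2 F) (hB : ¬ (B 0 1 = 0 ∧ B 1 0 = 0 ∧ B 0 0 = B 1 1))
    (hB2 : B 0 0 + B 1 1 ≠ -2) : Good σ B := by
  obtain ⟨ν, hν, hs⟩ := aux_nonsq e q₀ he hq hF σ hσ
  obtain ⟨⟨r, hr⟩, H⟩ := aux_core e q₀ he5 hq1 hF σ hσ
  by_cases h2 : B 0 0 + B 1 1 = 2
  · let k : SL2 F := mk2 1 r 0 1 (by ring)
    refine Good.trace hν hs (A := k⁻¹ * Matrix.SpecialLinearGroup.map (σ : F →+* F) k)
      ⟨1, k, by group⟩ ?_ hB ?_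
    · rintro ⟨h, -⟩
      apply hr
      simp only [sl_mul, sl_inv, sl_map, k, mk2_00, mk2_01, mk2_10, mk2_11, map_one, map_zero] at h
      linear_combination h
    · rw [h2]
      simp only [sl_mul, sl_inv, sl_map, k, mk2_00, mk2_01, mk2_10, mk2_11, map_one, map_zero]
      ring
  · obtain ⟨c, x, hc, hx⟩ := H r (B 0 0 + B 1 1) hr
    generalize hT : B 0 0 + B 1 1 = t at *
    let k : SL2 F := mk2 (r / c) (1 / c) (-(r * x) / c - c) (-x / c) (by
      field_simp; ring)
    have hsc : σ c ≠ 0 := by simpa using hc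
    have key : (k⁻¹ * Matrix.SpecialLinearGroup.map (σ : F →+* F) k) 0 0 +
        (k⁻¹ * Matrix.SpecialLinearGroup.map (σ : F →+* F) k) 1 1 = t := by
      simp only [sl_mul, sl_inv, sl_map, k, mk2_00, mk2_01, mk2_10, mk2_11, map_one, map_div₀,
        map_sub, map_neg, map_mul]
      rw [div_eq_iff hr] at hx
      field_simp
      linear_combination -hx
    have hdet := aux_det (k⁻¹ * Matrix.SpecialLinearGroup.map (σ : F →+* F) k)
    have hG : Good σ (k⁻¹ * Matrix.SpecialLinearGroup.map (σ : F →+* F) k) := ⟨1, k, by group⟩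
    generalize k⁻¹ * Matrix.SpecialLinearGroup.map (σ : F →+* F) k = A at *
    refine Good.trace hν hs hG ?_ hB (key.trans hT.symm)
    rintro ⟨h01, -, hd⟩
    rw [h01, hd] at hdet
    rw [hd] at key
    have : (t - 2) * (t + 2) = 0 := by rw [← key]; linear_combination 4 * hdet
    rcases mul_eq_zero.1 this with h | h
    · exact h2 (sub_eq_zero.1 h)
    · exact hB2 (eq_neg_of_add_eq_zero_left h)

/-- Lemma 3.1: Let `e ≥ 5` be odd, `q₀` an odd prime power, `q = q₀^e`, and `F` the field
with `q` elements. Let `α` be the automorphism of `H = PSL₂(F)` induced by the field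
automorphism `x ↦ x^{q₀}`. Then for every `y ∈ H` there are `g, h ∈ H` with
`y = g⁻¹ · α(g·h⁻¹) · h`; i.e. the conjugacy class `C` of `α` satisfies `C·C⁻¹ = H`. -/
theorem psl2_class_product_odd
    (e q₀ p k : ℕ) (he : Odd e) (he5 : 5 ≤ e)
    (hp : p.Prime) (hpodd : Odd p) (hk : 0 < k) (hq₀ : q₀ = p ^ k)
    (F : Type*) [Field F] [Fintype F] (hF : Fintype.card F = q₀ ^ e)
    (σ : F ≃+* F) (hσ : ∀ x : F, σ x = x ^ q₀)
    (α : MulAut (Matrix.SpecialLinearGroup (Fin 2) F ⧸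
      Subgroup.center (Matrix.SpecialLinearGroup (Fin 2) F)))
    (hα : ∀ A : Matrix.SpecialLinearGroup (Fin 2) F,
      α (QuotientGroup.mk A) =
        QuotientGroup.mk (Matrix.SpecialLinearGroup.map (σ : F →+* F) A)) :
    ∀ y : Matrix.SpecialLinearGroup (Fin 2) F ⧸
        Subgroup.center (Matrix.SpecialLinearGroup (Fin 2) F),
      ∃ g h : Matrix.SpecialLinearGroup (Fin 2) F ⧸
        Subgroup.center (Matrix.SpecialLinearGroup (Fin 2) F),
        y = g⁻¹ * α (g * h⁻¹) * h := by
  have hqo : Odd q₀ := hq₀ ▸ hpodd.pow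
  have hq1 : 1 < q₀ := hq₀ ▸ Nat.one_lt_pow hk.ne' hp.one_lt
  have main : ∀ B : SL2 F, Good σ B → ∃ g h : SL2 F ⧸ Subgroup.center (SL2 F),
      (QuotientGroup.mk B : SL2 F ⧸ Subgroup.center (SL2 F)) = g⁻¹ * α (g * h⁻¹) * h := by
    rintro B ⟨h, k, rfl⟩
    refine ⟨QuotientGroup.mk (k * h), QuotientGroup.mk h, ?_⟩
    have : (QuotientGroup.mk (k * h) : SL2 F ⧸ Subgroup.center (SL2 F)) *
        (QuotientGroup.mk h)⁻¹ = QuotientGroup.mk k := by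
      rw [QuotientGroup.mk_mul, mul_inv_cancel_right]
    rw [this, hα]
    simp only [QuotientGroup.mk_mul, QuotientGroup.mk_inv, mul_inv_rev, mul_assoc]
  have h2 : (2 : F) ≠ 0 := by
    have hodd : Odd (Fintype.card F) := hF ▸ hqo.pow
    have hchar : ringChar F ≠ 2 := by
      intro h
      have := FiniteField.even_card_of_char_two h
      rw [Nat.odd_iff] at hodd
      omega
    exact Ring.two_ne_zero hchar
  intro y
  induction y using QuotientGroup.induction_on with
  | H A =>
  by_cases hA : A 0 1 = 0 ∧ A 1 0 = 0 ∧ A 0 0 = A 1 1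
  · refine ⟨1, 1, ?_⟩
    have : (QuotientGroup.mk A : SL2 F ⧸ Subgroup.center (SL2 F)) = 1 := by
      rw [QuotientGroup.eq_one_iff, Matrix.SpecialLinearGroup.mem_center_iff]
      refine ⟨A 0 0, ?_, ?_⟩
      · have := aux_det A
        rw [hA.1, ← hA.2.2] at this
        simp only [Fintype.card_fin]
        linear_combination this
      · ext i j
        fin_cases i <;> fin_cases j <;> simp [hA.1, hA.2.1, hA.2.2]
    rw [this]
    simp
  · by_cases ht : A 0 0 + A 1 1 = -2
    · have hneg : (QuotientGroup.mk A : SL2 F ⧸ Subgroup.center (SL2 F)) =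
          QuotientGroup.mk (-A) := by
        rw [QuotientGroup.eq, Matrix.SpecialLinearGroup.mem_center_iff]
        refine ⟨-1, by simp, ?_⟩
        have : A⁻¹ * -A = -1 := by simp
        rw [this]
        ext i j
        fin_cases i <;> fin_cases j <;> simp
      rw [hneg]
      refine main _ (aux_good e q₀ he hqo hq1 he5 hF σ hσ _ ?_ ?_)
      · simpa using hA
      · simp only [Matrix.SpecialLinearGroup.coe_neg, Matrix.neg_apply]
        intro h
        have : (2 : F) * 2 = 0 := by linear_combination ht + h
        exact h2 (by simpa using this)
    · exact main _ (aux_good e q₀ he hqo hq1 he5 hF σ hσ _ hA ht)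
end

section
/- Let e ≥ 4 be a positive integer, q₀ a power of 2, and q = q₀^e. Let F be the finite field with q elements, let H = PSL₂(F) be the quotient of SL₂(F) by its center (which equals SL₂(F) in characteristic 2), and let α be the automorphism of H induced by the field automorphism x ↦ x^{q₀} of F (applied entrywise to matrices); α is a field automorphism of H of order e. Then for every y ∈ H there exist g, h ∈ H such that y = g⁻¹ · α(g·h⁻¹) · h. Equivalently, if C denotes the conjugacy class of α in the extension H⟨α⟩, then C·C⁻¹ = H. -/
open Matrix in
theorem aux_mk {F : Type*} [Field F] (a b c d : F) (h : a * d - b * c = 1) :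
    ∃ P : SpecialLinearGroup (Fin 2) F, P 0 0 = a ∧ P 0 1 = b ∧ P 1 0 = c ∧ P 1 1 = d :=
  ⟨⟨!![a, b; c, d], by rw [Matrix.det_fin_two_of, h]⟩, rfl, rfl, rfl, rfl⟩

open Matrix in
theorem aux_tr {F : Type*} [Field F] (σ : F →+* F) (t : SpecialLinearGroup (Fin 2) F) :
    (SpecialLinearGroup.map σ t * t⁻¹) 0 0 + (SpecialLinearGroup.map σ t * t⁻¹) 1 1
      = σ (t 0 0) * t 1 1 - σ (t 0 1) * t 1 0 - σ (t 1 0) * t 0 1 + σ (t 1 1) * t 0 0 := by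
  have h1 : ∀ i j, (SpecialLinearGroup.map σ t * t⁻¹) i j
      = σ (t i 0) * t⁻¹ 0 j + σ (t i 1) * t⁻¹ 1 j := by
    intro i j
    have := congrFun (congrFun (Matrix.SpecialLinearGroup.coe_mul (SpecialLinearGroup.map σ t) t⁻¹) i) j
    rw [Matrix.mul_apply, Fin.sum_univ_two] at this
    exact this
  have h2 : ∀ i j, t⁻¹ i j = (!![t 1 1, - t 0 1; - t 1 0, t 0 0] : Matrix (Fin 2) (Fin 2) F) i j := by
    intro i j
    have := Matrix.SpecialLinearGroup.coe_inv t
    rw [Matrix.adjugate_fin_two] at this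
    exact congrFun (congrFun this i) j
  rw [h1, h1, h2, h2, h2, h2]
  simp
  ring

open Matrix in
theorem aux_conj_companion {F : Type*} [Field F] [CharP F 2]
    (hs : ∀ x : F, ∃ r : F, r * r = x) (A : SpecialLinearGroup (Fin 2) F) (hA : A ≠ 1)
    (B : SpecialLinearGroup (Fin 2) F)
    (hB : (B : Matrix (Fin 2) (Fin 2) F) = !![0, -1; 1, A 0 0 + A 1 1]) :
    ∃ P : SpecialLinearGroup (Fin 2) F, A = P * B * P⁻¹ := by
  have hdet : A 0 0 * A 1 1 - A 0 1 * A 1 0 = 1 := by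
    have := A.det_coe
    rwa [Matrix.det_fin_two] at this
  -- find a cyclic vector
  have hv : ∃ m n : F, m * (A 1 0 * m + A 1 1 * n) - (A 0 0 * m + A 0 1 * n) * n ≠ 0 := by
    by_contra hcon
    push Not at hcon
    have h1 : A 1 0 = 0 := by simpa using hcon 1 0
    have h2 : A 0 1 = 0 := by simpa using hcon 0 1
    have h3 : A 1 1 = A 0 0 := by
      have := hcon 1 1
      rw [h1, h2] at this
      linear_combination this
    rw [h1, h3] at hdet
    have h2' : (2 : F) = 0 := CharTwo.two_eq_zero
    have h4 : A 0 0 = 1 := by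
      have : (A 0 0 - 1) ^ 2 = 0 := by
        linear_combination hdet + (1 - A 0 0) * h2'
      have := pow_eq_zero_iff (two_ne_zero) |>.1 this
      linear_combination this
    apply hA
    ext i j
    fin_cases i <;> fin_cases j <;> simp [h1, h2, h3, h4]
  obtain ⟨m, n, hmn⟩ := hv
  obtain ⟨r, hr⟩ := hs (m * (A 1 0 * m + A 1 1 * n) - (A 0 0 * m + A 0 1 * n) * n)
  have hr0 : r ≠ 0 := by
    rintro rfl
    exact hmn (by rw [← hr]; simp)
  obtain ⟨P, h00, h01, h10, h11⟩ := aux_mk (m / r) ((A 0 0 * m + A 0 1 * n) / r) (n / r)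
    ((A 1 0 * m + A 1 1 * n) / r) (by field_simp; linear_combination -hr)
  refine ⟨P, ?_⟩
  rw [eq_mul_inv_iff_mul_eq]
  ext i j
  fin_cases i <;> fin_cases j <;>
    simp [Matrix.mul_apply, Fin.sum_univ_two, hB, h00, h01, h10, h11] <;> field_simp
  · linear_combination -m * hdet
  · linear_combination -n * hdet

theorem aux_field {F : Type*} [Field F] [Finite F] [CharP F 2] (σ : F →+* F)
    (hK : (Nat.card {x : F // σ x = x}) ^ 2 < Nat.card F) (τ : F) :
    ∃ u x y : F, u ≠ 0 ∧ (σ x - x) * (σ y - y) = σ u ^ 2 + τ * (u * σ u) + u ^ 2 := by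
  classical
  have h2 : (2 : F) = 0 := CharTwo.two_eq_zero
  let D : F →+ F := (σ : F →+ F) - AddMonoidHom.id F
  have hD : ∀ x, D x = σ x - x := fun x => rfl
  let I : AddSubgroup F := D.range
  let K : AddSubgroup F := D.ker
  have hKm : ∀ x, x ∈ K ↔ σ x = x := fun x => by
    rw [AddMonoidHom.mem_ker, hD, sub_eq_zero]
  have hKc : Nat.card K = Nat.card {x : F // σ x = x} :=
    Nat.card_congr (Equiv.subtypeEquivRight hKm)
  rw [← hKc] at hK
  have hIK : Nat.card I * Nat.card K = Nat.card F := by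
    have h1 := AddSubgroup.card_mul_index K
    have h3 : K.index = Nat.card I := AddSubgroup.index_ker D
    rw [← h1, h3, mul_comm]
  have hQ : Nat.card (F ⧸ I) = Nat.card K := by
    have h1 := AddSubgroup.card_mul_index I
    rw [← hIK] at h1
    exact Nat.eq_of_mul_eq_mul_left Nat.card_pos h1
  have hK2 : 1 < Nat.card K := by
    rw [Finite.one_lt_card_iff_nontrivial]
    refine ⟨⟨⟨0, K.zero_mem⟩, ⟨1, (hKm 1).2 (map_one σ)⟩, ?_⟩⟩
    simp
  have hImul : ∀ c z, σ c = c → z ∈ I → c * z ∈ I := by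
    rintro c _ hc ⟨z, rfl⟩
    refine ⟨c * z, ?_⟩
    rw [hD, hD, map_mul, hc]; ring
  -- non-injectivity by counting, for homs into `F ⧸ I`
  obtain ⟨x, hx⟩ : ∃ x, σ x - x ≠ 0 := by
    by_contra hcon
    push Not at hcon
    have : K = ⊤ := by
      ext z; simp [hKm, ← sub_eq_zero, hcon z]
    rw [this] at hK hK2
    simp only [AddSubgroup.card_top] at hK hK2
    nlinarith
  set w := σ x - x with hw
  -- a vector orthogonal to 1
  obtain ⟨v, hvK, hv⟩ : ∃ v, σ v ≠ v ∧ τ * (v + σ v) / w ∈ I := by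
    let f : F →+ F ⧸ I := (QuotientAddGroup.mk' I).comp
      ((AddMonoidHom.mulLeft (τ / w)).comp (AddMonoidHom.id F + (σ : F →+ F)))
    by_contra hcon
    push Not at hcon
    have hle : f.ker ≤ K := by
      intro v hv
      rw [hKm]
      by_contra hne
      apply hcon v hne
      have : ((τ / w * (v + σ v) : F) : F ⧸ I) = 0 := hv
      rw [QuotientAddGroup.eq_zero_iff] at this
      convert this using 1
      ring
    have h1 := AddSubgroup.card_mul_index f.ker
    rw [AddSubgroup.index_ker f] at h1
    have h3 : Nat.card f.range ≤ Nat.card (F ⧸ I) :=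
      Nat.card_le_card_of_injective _ Subtype.val_injective
    have h4 : Nat.card f.ker ≤ Nat.card K := AddSubgroup.card_le_of_le hle
    rw [hQ] at h3
    have := Nat.mul_le_mul h4 h3
    rw [h1] at this
    nlinarith
  let q : F → F := fun u => σ u ^ 2 + τ * (u * σ u) + u ^ 2
  -- combination of 1 and v
  obtain ⟨s, t, hs, ht, hst, hmem⟩ : ∃ s t, σ s = s ∧ σ t = t ∧ ¬ (s = 0 ∧ t = 0) ∧
      s ^ 2 * (q 1 / w) + t ^ 2 * (q v / w) ∈ I := by
    let g : K × K → F ⧸ I := fun p =>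
      (((p.1 : F) ^ 2 * (q 1 / w) + (p.2 : F) ^ 2 * (q v / w) : F) : F ⧸ I)
    have hg : ¬ Function.Injective g := by
      intro hinj
      have := Nat.card_le_card_of_injective g hinj
      rw [Nat.card_prod, hQ] at this
      nlinarith
    rw [Function.Injective] at hg
    push Not at hg
    obtain ⟨p, p', hpp, hne⟩ := hg
    have hp1 := (hKm _).1 p.1.2
    have hp2 := (hKm _).1 p.2.2
    have hp1' := (hKm _).1 p'.1.2
    have hp2' := (hKm _).1 p'.2.2
    refine ⟨p'.1 - p.1, p'.2 - p.2, by rw [map_sub, hp1, hp1'], by rw [map_sub, hp2, hp2'], ?_, ?_⟩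
    · rintro ⟨h3, h4⟩
      apply hne
      rw [sub_eq_zero] at h3 h4
      exact Prod.ext (Subtype.ext h3.symm) (Subtype.ext h4.symm)
    · have h5 := QuotientAddGroup.eq.1 hpp
      convert h5 using 1
      linear_combination (((p.1 : F) ^ 2 - p.1 * p'.1) * (q 1 / w)
        + ((p.2 : F) ^ 2 - p.2 * p'.2) * (q v / w)) * h2
  have hu : s + t * v ≠ 0 := by
    intro h0
    by_cases ht0 : t = 0
    · apply hst
      rw [ht0] at h0
      exact ⟨by simpa using h0, ht0⟩
    · apply hvK
      have : σ (s + t * v) = 0 := by rw [h0, map_zero]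
      rw [map_add, map_mul, hs, ht] at this
      exact mul_left_cancel₀ ht0 (by linear_combination this - h0)
  have hqI : q (s + t * v) / w ∈ I := by
    have h6 := I.add_mem hmem (hImul (s * t) _ (by rw [map_mul, hs, ht]) hv)
    convert h6 using 1
    simp only [q, map_add, map_mul, hs, ht, map_one]
    field_simp
    linear_combination (s * t * (v + σ v)) * h2
  obtain ⟨y, hy⟩ := hqI
  refine ⟨s + t * v, x, y, hu, ?_⟩
  rw [← hw, ← hD y, hy]
  rw [mul_div_cancel₀ _ hx]

open Matrix in
theorem aux_trace {F : Type*} [Field F] [Finite F] [CharP F 2] (σ : F →+* F)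
    (hK : (Nat.card {x : F // σ x = x}) ^ 2 < Nat.card F) (τ : F) :
    ∃ t : SpecialLinearGroup (Fin 2) F,
      (SpecialLinearGroup.map σ t * t⁻¹) ≠ 1 ∧
      (SpecialLinearGroup.map σ t * t⁻¹) 0 0 + (SpecialLinearGroup.map σ t * t⁻¹) 1 1 = τ := by
  have h2 : (2 : F) = 0 := CharTwo.two_eq_zero
  by_cases hτ : τ = 0
  · subst hτ
    obtain ⟨b, hb⟩ : ∃ b, σ b ≠ b := by
      by_contra hcon
      push Not at hcon
      have : Nat.card {x : F // σ x = x} = Nat.card F :=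
        Nat.card_congr (Equiv.subtypeUnivEquiv hcon)
      rw [this] at hK
      have : 0 < Nat.card F := Nat.card_pos
      nlinarith
    obtain ⟨t, h00, h01, h10, h11⟩ := aux_mk 1 b 0 1 (by ring)
    refine ⟨t, ?_, ?_⟩
    · intro h
      rw [mul_inv_eq_one] at h
      have := congrArg (fun M : SpecialLinearGroup (Fin 2) F => M 0 1) h
      simp [h01] at this
      exact hb this
    · rw [aux_tr, h00, h01, h10, h11]
      simp
      linear_combination h2
  · obtain ⟨u, x, y, hu, h⟩ := aux_field σ hK τ
    have hσu : σ u ≠ 0 := by simpa using hu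
    obtain ⟨t, h00, h01, h10, h11⟩ := aux_mk (x / u) ((x / u * (y / u) - 1) * u) (1 / u) (y / u)
      (by field_simp; ring)
    have htr : (SpecialLinearGroup.map σ t * t⁻¹) 0 0
        + (SpecialLinearGroup.map σ t * t⁻¹) 1 1 = τ := by
      rw [aux_tr, h00, h01, h10, h11]
      simp only [map_mul, map_sub, map_div₀, map_one]
      field_simp
      linear_combination -h - (u * σ u * τ) * h2
    refine ⟨t, ?_, htr⟩
    intro h1
    rw [h1] at htr
    apply hτ
    rw [← htr]
    simp
    linear_combination h2

theorem aux_main {F : Type*} [Field F] [Finite F] [CharP F 2] (σ : F →+* F)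
    (hK : (Nat.card {x : F // σ x = x}) ^ 2 < Nat.card F)
    (A : Matrix.SpecialLinearGroup (Fin 2) F) :
    ∃ g h : Matrix.SpecialLinearGroup (Fin 2) F,
      A = g⁻¹ * Matrix.SpecialLinearGroup.map σ (g * h⁻¹) * h := by
  by_cases hA : A = 1
  · exact ⟨1, 1, by simp [hA]⟩
  have hs : ∀ x : F, ∃ r : F, r * r = x := by
    intro x
    have hinj : Function.Injective (frobenius F 2) := frobenius_inj F 2
    obtain ⟨r, hr⟩ := Finite.surjective_of_injective hinj x
    exact ⟨r, by rw [← hr, frobenius_def, sq]⟩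
  obtain ⟨t, ht1, htr⟩ := aux_trace σ hK (A 0 0 + A 1 1)
  let B : Matrix.SpecialLinearGroup (Fin 2) F :=
    ⟨!![0, -1; 1, A 0 0 + A 1 1], by rw [Matrix.det_fin_two_of]; ring⟩
  obtain ⟨P, hP⟩ := aux_conj_companion hs A hA B rfl
  obtain ⟨R, hR⟩ := aux_conj_companion hs _ ht1 B (by rw [htr])
  have hAB : A = (P * R⁻¹) * (Matrix.SpecialLinearGroup.map σ t * t⁻¹) * (P * R⁻¹)⁻¹ := by
    rw [hR, hP]; group
  refine ⟨(P * R⁻¹)⁻¹, t⁻¹ * (P * R⁻¹)⁻¹, ?_⟩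
  have e1 : (P * R⁻¹)⁻¹ * (t⁻¹ * (P * R⁻¹)⁻¹)⁻¹ = t := by group
  rw [e1, inv_inv, ← mul_assoc, mul_assoc (P * R⁻¹)]
  exact hAB

/-- Lemma 3.2: Let `e ≥ 4`, `q₀` a power of `2`, `q = q₀^e`, and `F` the field with `q`
elements. Let `α` be the automorphism of `H = PSL₂(F)` induced by the field automorphism
`x ↦ x^{q₀}`. Then for every `y ∈ H` there are `g, h ∈ H` with `y = g⁻¹ · α(g·h⁻¹) · h`;
i.e. the conjugacy class `C` of `α` satisfies `C·C⁻¹ = H`. -/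
theorem psl2_class_product_even
    (e q₀ k : ℕ) (he4 : 4 ≤ e) (hk : 0 < k) (hq₀ : q₀ = 2 ^ k)
    (F : Type*) [Field F] [Fintype F] (hF : Fintype.card F = q₀ ^ e)
    (σ : F ≃+* F) (hσ : ∀ x : F, σ x = x ^ q₀)
    (α : MulAut (Matrix.SpecialLinearGroup (Fin 2) F ⧸
      Subgroup.center (Matrix.SpecialLinearGroup (Fin 2) F)))
    (hα : ∀ A : Matrix.SpecialLinearGroup (Fin 2) F,
      α (QuotientGroup.mk A) =
        QuotientGroup.mk (Matrix.SpecialLinearGroup.map (σ : F →+* F) A)) :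
    ∀ y : Matrix.SpecialLinearGroup (Fin 2) F ⧸
        Subgroup.center (Matrix.SpecialLinearGroup (Fin 2) F),
      ∃ g h : Matrix.SpecialLinearGroup (Fin 2) F ⧸
        Subgroup.center (Matrix.SpecialLinearGroup (Fin 2) F),
        y = g⁻¹ * α (g * h⁻¹) * h := by
  classical
  have hcard : Nat.card F = q₀ ^ e := by rw [Nat.card_eq_fintype_card, hF]
  have hq2 : 2 ≤ q₀ := by
    rw [hq₀]
    calc 2 = 2 ^ 1 := by norm_num
      _ ≤ 2 ^ k := Nat.pow_le_pow_right (by norm_num) hk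
  have : CharP F 2 := by
    obtain ⟨p, hp⟩ := CharP.exists F
    have hpp : p.Prime := CharP.char_is_prime F p
    have h0 : ((Fintype.card F : ℕ) : F) = 0 := Nat.cast_card_eq_zero F
    rw [CharP.cast_eq_zero_iff F p, hF, hq₀, ← pow_mul] at h0
    have := (Nat.prime_dvd_prime_iff_eq hpp Nat.prime_two).1 (hpp.dvd_of_dvd_pow h0)
    rwa [this] at hp
  have hK : (Nat.card {x : F // (σ : F →+* F) x = x}) ^ 2 < Nat.card F := by
    have hle : Nat.card {x : F // (σ : F →+* F) x = x} ≤ q₀ := by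
      let p : Polynomial F := Polynomial.X ^ q₀ - Polynomial.X
      have hp0 : p ≠ 0 := FiniteField.X_pow_card_sub_X_ne_zero F (by omega)
      have hdeg : p.natDegree = q₀ := FiniteField.X_pow_card_sub_X_natDegree_eq F (by omega)
      have h1 : Nat.card {x : F // (σ : F →+* F) x = x} ≤ Nat.card p.roots.toFinset := by
        refine Nat.card_le_card_of_injective
          (fun x => (⟨x.1, ?_⟩ : p.roots.toFinset)) ?_
        · have hx : σ x.1 = x.1 := x.2
          rw [hσ] at hx
          rw [Multiset.mem_toFinset, Polynomial.mem_roots hp0]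
          simp [p, hx]
        · intro x y hxy
          exact Subtype.ext (congrArg (fun z : p.roots.toFinset => (z : F)) hxy)
      rw [Nat.card_eq_fintype_card (α := p.roots.toFinset), Fintype.card_coe] at h1
      exact h1.trans ((Multiset.toFinset_card_le _).trans
        ((Polynomial.card_roots' p).trans hdeg.le))
    rw [hcard]
    calc _ ≤ q₀ ^ 2 := Nat.pow_le_pow_left hle 2
      _ < q₀ ^ e := Nat.pow_lt_pow_right (by omega) (by omega)
  intro y
  obtain ⟨A, rfl⟩ := QuotientGroup.mk_surjective y
  obtain ⟨g, h, hgh⟩ := aux_main (σ : F →+* F) hK A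
  refine ⟨QuotientGroup.mk g, QuotientGroup.mk h, ?_⟩
  rw [← QuotientGroup.mk_inv, ← QuotientGroup.mk_inv, ← QuotientGroup.mk_mul, hα,
    ← QuotientGroup.mk_mul, ← QuotientGroup.mk_mul, ← hgh]
end

section
/- There exists a function l : ℕ → ℕ such that the following holds. Let p be a prime and G a finite p-group of exponent p (x^p = 1 for all x ∈ G) admitting an automorphism α whose order is coprime to |G|, with G = [G,α]. Suppose that every subgroup of G generated by a subset of I_G(α) can be generated by at most r elements. Then every subgroup of G can be generated by at most l(r) elements; that is, the rank of G is at most l(r). -/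
namespace RankExp

open Subgroup
open scoped commutatorElement

universe u

lemma rel_mul_card {G : Type u} [Group G] [Finite G] (M N : Subgroup G) (h : M ≤ N) :
    M.relIndex N * Nat.card M = Nat.card N := by
  have := relIndex_mul_relIndex ⊥ M N bot_le h
  rw [relIndex_bot_left, relIndex_bot_left] at this
  rw [mul_comm, this]

lemma rel_ne_zero {G : Type u} [Group G] [Finite G] {M N : Subgroup G} :
    M.relIndex N ≠ 0 := index_ne_zero_of_finite

/-- A proper inclusion of subgroups of a finite `p`-group has index at least `p`. -/
lemma card_mul_le_of_lt {p : ℕ} (hp : p.Prime) {G : Type u} [Group G] [Finite G]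
    (hG : IsPGroup p G) {M N : Subgroup G} (h : M < N) :
    p * Nat.card M ≤ Nat.card N := by
  have : Fact p.Prime := ⟨hp⟩
  have h1 := rel_mul_card M N h.le
  obtain ⟨n, hn⟩ := (hG.to_subgroup N).index (M.subgroupOf N)
  have h2 : M.relIndex N = p ^ n := hn
  have h3 : M.relIndex N ≠ 1 := by
    rw [Ne, relIndex_eq_one]
    exact not_le_of_gt h
  have h4 : n ≠ 0 := by
    rintro rfl
    exact h3 (by simpa using h2)
  have h5 : p ≤ M.relIndex N := by
    rw [h2]
    exact Nat.le_self_pow h4 p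
  calc p * Nat.card M ≤ M.relIndex N * Nat.card M := Nat.mul_le_mul_right _ h5
    _ = _ := h1

/-- Greedy choice of generators modulo a subgroup. -/
lemma greedy {p : ℕ} (hp : p.Prime) {G : Type u} [Group G] [Finite G]
    (hG : IsPGroup p G) (M : Subgroup G) (S : Set G) :
    ∃ T : Finset G, (T : Set G) ⊆ S ∧ closure (T : Set G) ⊔ M = closure S ⊔ M ∧
      p ^ T.card * Nat.card M ≤ Nat.card (closure S ⊔ M : Subgroup G) := by
  classical
  letI := Fintype.ofFinite G
  let P : Finset (Finset G) := Finset.univ.filter fun T =>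
    (T : Set G) ⊆ S ∧ p ^ T.card * Nat.card M ≤ Nat.card (closure (T : Set G) ⊔ M : Subgroup G)
  have hP : P.Nonempty := ⟨∅, by simp [P]⟩
  obtain ⟨T, hT, hmax⟩ := P.exists_max_image Finset.card hP
  simp only [P, Finset.mem_filter, Finset.mem_univ, true_and] at hT hmax
  have key : S ⊆ (closure (T : Set G) ⊔ M : Subgroup G) := by
    intro s hs
    by_contra hns
    have hsT : s ∉ T := fun h => hns (Subgroup.mem_sup_left (subset_closure h))
    have hlt : (closure (T : Set G) ⊔ M : Subgroup G) <
        closure ((insert s T : Finset G) : Set G) ⊔ M := by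
      refine lt_of_le_of_ne (sup_le_sup_right (Subgroup.closure_mono (by simp)) _) ?_
      intro h
      apply hns
      rw [h]
      exact Subgroup.mem_sup_left (subset_closure (by simp))
    have := card_mul_le_of_lt hp hG hlt
    have h2 := hmax (insert s T) ⟨?_, ?_⟩
    · rw [Finset.card_insert_of_notMem hsT] at h2
      omega
    · rw [Finset.coe_insert]
      exact Set.insert_subset hs hT.1
    · rw [Finset.card_insert_of_notMem hsT, pow_succ']
      calc p * p ^ T.card * Nat.card M = p * (p ^ T.card * Nat.card M) := by ring
        _ ≤ p * _ := Nat.mul_le_mul_left _ hT.2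
        _ ≤ _ := this
  have heq : closure (T : Set G) ⊔ M = closure S ⊔ M :=
    le_antisymm (sup_le_sup_right (Subgroup.closure_mono hT.1) _)
      (sup_le ((closure_le _).2 key) le_sup_right)
  exact ⟨T, hT.1, heq, heq ▸ hT.2⟩

/-- Order bound for a subgroup generated modulo a normal subgroup with abelian quotient. -/
lemma card_closure_sup_le {p : ℕ} (hp : p.Prime) {G : Type u} [Group G] [Finite G]
    (hexp : ∀ x : G, x ^ p = 1) (N : Subgroup G) (hN : commutator G ≤ N) (T : Finset G) :
    Nat.card (closure (T : Set G) ⊔ N : Subgroup G) ≤ p ^ T.card * Nat.card N := by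
  classical
  induction T using Finset.induction_on with
  | empty => simp
  | insert x T hx ih =>
    have hnorm : (closure (T : Set G) ⊔ N).Normal :=
      Subgroup.Normal.of_commutator_le _ (hN.trans le_sup_right)
    have h1 : closure ((insert x T : Finset G) : Set G) ⊔ N =
        zpowers x ⊔ (closure (T : Set G) ⊔ N) := by
      rw [Finset.coe_insert, Set.insert_eq, Subgroup.closure_union, sup_assoc, zpowers_eq_closure]
    rw [h1, Finset.card_insert_of_notMem hx]
    have h2 := rel_mul_card (closure (T : Set G) ⊔ N)
      (zpowers x ⊔ (closure (T : Set G) ⊔ N)) le_sup_right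
    rw [relIndex_sup_right] at h2
    have h3 : (closure (T : Set G) ⊔ N).relIndex (zpowers x) ≤ p := by
      have : (closure (T : Set G) ⊔ N).relIndex (zpowers x) ∣ Nat.card (zpowers x) :=
        Subgroup.relIndex_dvd_card _ _
      refine (Nat.le_of_dvd Nat.card_pos this).trans ?_
      rw [Nat.card_zpowers]
      exact Nat.le_of_dvd hp.pos (orderOf_dvd_of_pow_eq_one (hexp x))
    rw [← h2, pow_succ']
    calc _ ≤ p * (p ^ T.card * Nat.card N) := Nat.mul_le_mul h3 ih
      _ = _ := by ring

/-- A normal subgroup not inside another has an element outside, central modulo the latter. -/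
lemma exists_central_mod {p : ℕ} (hp : p.Prime) {G : Type u} [Group G] [Finite G]
    (hG : IsPGroup p G) (M N : Subgroup G) [N.Normal] (h : ¬ N ≤ M) :
    ∃ y ∈ N, y ∉ M ∧ ∀ g, ⁅y, g⁆ ∈ M := by
  have : Fact p.Prime := ⟨hp⟩
  have : Group.IsNilpotent G := hG.isNilpotent
  obtain ⟨n, hn⟩ := Subgroup.nilpotent_iff_lowerCentralSeries.1 ‹Group.IsNilpotent G›
  by_contra! hcon
  have : ∀ k, ¬ (N ⊓ (⊤ : Subgroup G).lowerCentralSeries k ≤ M) := by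
    intro k
    induction k with
    | zero => simpa using h
    | succ k ih =>
      intro hk
      apply ih
      intro y hy
      by_contra hyM
      obtain ⟨g, hg⟩ := hcon y hy.1 hyM
      apply hg
      apply hk
      refine ⟨?_, ?_⟩
      · exact Subgroup.commutator_le_left N ⊤ (commutator_mem_commutator hy.1 (mem_top g))
      · exact commutator_mem_commutator hy.2 (mem_top g)
  exact this n (by simp [hn])

/-- The commutator subgroup consists of non-generators. -/
lemma closure_eq_top {p : ℕ} (hp : p.Prime) {G : Type u} [Group G] [Finite G]
    (hG : IsPGroup p G) (H : Subgroup G) (h : H ⊔ commutator G = ⊤) : H = ⊤ := by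
  have : Fact p.Prime := ⟨hp⟩
  have : Group.IsNilpotent G := hG.isNilpotent
  rcases eq_top_or_exists_le_coatom H with h1 | ⟨M, hM, hHM⟩
  · exact h1
  · exfalso
    have hN : M.Normal := (Group.normalizerCondition_of_isNilpotent).normal_of_coatom M hM
    obtain ⟨y, -, hy, hc⟩ := exists_central_mod hp hG M ⊤ (by
      rw [top_le_iff]; exact hM.1)
    have hle : commutator G ≤ M := by
      have hcomap : (center (G ⧸ M)).comap (QuotientGroup.mk' M) = ⊤ := by
        apply hM.2
        refine lt_of_le_of_ne ?_ ?_
        · intro x hx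
          have : QuotientGroup.mk' M x = 1 := by simpa using hx
          rw [mem_comap, this]
          exact one_mem _
        · intro heq
          apply hy
          rw [heq, mem_comap, mem_center_iff]
          intro q
          obtain ⟨g, rfl⟩ := QuotientGroup.mk'_surjective M q
          have := (QuotientGroup.eq_one_iff _).2 (hc g)
          have h3 : ⁅QuotientGroup.mk' M y, QuotientGroup.mk' M g⁆ = 1 := by
            rw [← map_commutatorElement]; exact this
          exact (commutatorElement_eq_one_iff_mul_comm.1 h3).symm
      rw [commutator_def, commutator_le]
      intro a _ b _
      have ha : a ∈ (center (G ⧸ M)).comap (QuotientGroup.mk' M) := hcomap ▸ mem_top a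
      rw [mem_comap, mem_center_iff] at ha
      have := ha (QuotientGroup.mk' M b)
      rw [← QuotientGroup.eq_one_iff]
      change QuotientGroup.mk' M _ = 1
      rw [map_commutatorElement, commutatorElement_eq_one_iff_mul_comm]
      exact this.symm
    exact hM.1 (top_le_iff.1 (h ▸ sup_le hHM hle))

/-- Wiegold-type bound for `[N, G]`. -/
lemma card_commutator_le {p : ℕ} (hp : p.Prime) (r m : ℕ) :
    ∀ (G : Type u) [Group G] [Finite G], IsPGroup p G → (∀ x : G, x ^ p = 1) →
      ∀ T : Finset G, T.card ≤ r → closure (T : Set G) = ⊤ →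
      ∀ N : Subgroup G, N.Normal → (center G).relIndex N ≤ p ^ m →
      Nat.card (⁅N, (⊤ : Subgroup G)⁆ : Subgroup G) ≤ p ^ (r * m) := by
  have triv : ∀ (G : Type u) [Group G] [Finite G] (N : Subgroup G), N ≤ center G → ∀ k,
      Nat.card (⁅N, (⊤ : Subgroup G)⁆ : Subgroup G) ≤ p ^ k := by
    intro G _ _ N hN k
    have : ⁅N, (⊤ : Subgroup G)⁆ = ⊥ := by
      rw [commutator_eq_bot_iff_le_centralizer]
      rw [coe_top, centralizer_univ]
      exact hN
    rw [this, card_bot]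
    exact Nat.one_le_pow _ _ hp.pos
  induction m with
  | zero =>
    intro G _ _ hG hexp T hT hcl N hN hm
    apply triv
    rw [← relIndex_eq_one]
    have : (center G).relIndex N ≠ 0 := rel_ne_zero
    simp at hm
    omega
  | succ m ih =>
    intro G _ _ hG hexp T hT hcl N hN hm
    by_cases hNc : N ≤ center G
    · exact triv G N hNc _
    obtain ⟨y, hyN, hyc, hy⟩ := exists_central_mod hp hG (center G) N hNc
    let φ : G →* center G := MonoidHom.mk' (fun g => ⟨⁅y, g⁆, hy g⟩) (by
      intro a b
      ext
      have h1 := mem_center_iff.1 (hy b) a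
      change ⁅y, a * b⁆ = ⁅y, a⁆ * ⁅y, b⁆
      have : ⁅y, a * b⁆ = ⁅y, a⁆ * (a * ⁅y, b⁆ * a⁻¹) := by
        simp only [commutatorElement_def]; group
      rw [this, h1]; group)
    have hφ : ∀ g, ((φ g : center G) : G) = ⁅y, g⁆ := fun g => rfl
    let D : Subgroup G := φ.range.map (center G).subtype
    have hDc : D ≤ center G := by
      rintro _ ⟨z, -, rfl⟩
      exact z.2
    have hmemD : ∀ g, ⁅y, g⁆ ∈ D := fun g => ⟨φ g, ⟨g, rfl⟩, rfl⟩
    have hDn : D.Normal := ⟨fun n hn g => by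
      have := mem_center_iff.1 (hDc hn) g
      rw [this]; simpa using hn⟩
    have hDcard : Nat.card D ≤ p ^ r := by
      classical
      have e1 : Nat.card D = Nat.card φ.range :=
        Nat.card_congr (φ.range.equivMapOfInjective _ (center G).subtype_injective).symm.toEquiv
      have e2 : φ.range = closure ((T.image φ : Finset (center G)) : Set (center G)) := by
        rw [Finset.coe_image, ← MonoidHom.map_closure, hcl, MonoidHom.range_eq_map]
      have e3 := card_closure_sup_le hp (G := center G)
        (fun x => Subtype.ext (by simpa using hexp x)) ⊥ (by
          rw [commutator_def, commutator_le]
          intro a _ b _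
          rw [mem_bot, commutatorElement_eq_one_iff_mul_comm]
          exact Subtype.ext (mem_center_iff.1 b.2 a)) (T.image φ)
      rw [sup_bot_eq, ← e2, ← e1, card_bot, mul_one] at e3
      exact e3.trans (Nat.pow_le_pow_right hp.pos (Finset.card_image_le.trans hT))
    -- pass to the quotient
    let π := QuotientGroup.mk' D
    have hπ : Function.Surjective π := QuotientGroup.mk'_surjective D
    have hquot : (center (G ⧸ D)).relIndex (N.map π) ≤ p ^ m := by
      rw [← relIndex_comap]
      have hcle : center G ≤ (center (G ⧸ D)).comap π := by
        intro z hz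
        rw [mem_comap, mem_center_iff]
        intro q
        obtain ⟨g, rfl⟩ := hπ q
        rw [← map_mul, ← map_mul, mem_center_iff.1 hz g]
      have hyc' : y ∈ (center (G ⧸ D)).comap π := by
        rw [mem_comap, mem_center_iff]
        intro q
        obtain ⟨g, rfl⟩ := hπ q
        have h3 : ⁅π y, π g⁆ = 1 := by
          rw [← map_commutatorElement]; exact (QuotientGroup.eq_one_iff _).2 (hmemD g)
        exact (commutatorElement_eq_one_iff_mul_comm.1 h3).symm
      have hlt : center G ⊓ N < (center (G ⧸ D)).comap π ⊓ N := by
        refine lt_of_le_of_ne (inf_le_inf_right _ hcle) ?_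
        intro h
        have : y ∈ center G ⊓ N := h ▸ ⟨hyc', hyN⟩
        exact hyc this.1
      have c1 := card_mul_le_of_lt hp hG hlt
      have c2 := rel_mul_card _ _ hlt.le
      have c3 : p ≤ (center G ⊓ N).relIndex ((center (G ⧸ D)).comap π ⊓ N) := by
        rw [← c2] at c1
        exact Nat.le_of_mul_le_mul_right c1 Nat.card_pos
      have c4 := relIndex_mul_relIndex _ _ N hlt.le inf_le_right
      rw [inf_relIndex_right, inf_relIndex_right] at c4
      have c5 : p * ((center (G ⧸ D)).comap π).relIndex N ≤ p * p ^ m := by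
        rw [← pow_succ', ]
        refine le_trans ?_ hm
        rw [← c4]
        exact Nat.mul_le_mul_right _ c3
      exact Nat.le_of_mul_le_mul_left c5 hp.pos
    classical
    have hrec := ih (G ⧸ D) (hG.to_quotient D) (by
        intro q
        obtain ⟨g, rfl⟩ := hπ q
        rw [← map_pow, hexp, map_one]) (T.image π) (Finset.card_image_le.trans hT) (by
        rw [Finset.coe_image, ← MonoidHom.map_closure, hcl, ← MonoidHom.range_eq_map,
          MonoidHom.range_eq_top.2 hπ]) (N.map π) (hN.map π hπ) hquot
    have hmap : ⁅N.map π, (⊤ : Subgroup (G ⧸ D))⁆ = (⁅N, (⊤ : Subgroup G)⁆).map π := by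
      rw [map_commutator, ← MonoidHom.range_eq_map, MonoidHom.range_eq_top.2 hπ]
    rw [hmap] at hrec
    have f1 := rel_mul_card D (⁅N, (⊤ : Subgroup G)⁆ ⊔ D) le_sup_right
    rw [relIndex_sup_right] at f1
    have f2 : D.relIndex ⁅N, (⊤ : Subgroup G)⁆ =
        Nat.card ((⁅N, (⊤ : Subgroup G)⁆).map π) := by
      have := relIndex_comap (⊥ : Subgroup (G ⧸ D)) π ⁅N, (⊤ : Subgroup G)⁆
      rw [relIndex_bot_left] at this
      rw [← this, MonoidHom.comap_bot, QuotientGroup.ker_mk']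
    calc Nat.card (⁅N, (⊤ : Subgroup G)⁆ : Subgroup G)
        ≤ Nat.card (⁅N, (⊤ : Subgroup G)⁆ ⊔ D : Subgroup G) :=
          Nat.card_le_card_of_injective _ (inclusion_injective le_sup_left)
      _ = Nat.card ((⁅N, (⊤ : Subgroup G)⁆).map π) * Nat.card D := by rw [← f1, f2]
      _ ≤ p ^ (r * m) * p ^ r := Nat.mul_le_mul hrec hDcard
      _ = p ^ (r * (m + 1)) := by rw [← pow_add, mul_add, mul_one]

/-- Order of a group from the index of its center. -/
lemma card_le_of_center {p : ℕ} (hp : p.Prime) {G : Type u} [Group G] [Finite G]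
    (hG : IsPGroup p G) (hexp : ∀ x : G, x ^ p = 1) (r m : ℕ)
    (T : Finset G) (hT : T.card ≤ r) (hcl : closure (T : Set G) = ⊤)
    (hm : (center G).index ≤ p ^ m) : Nat.card G ≤ p ^ (r + r * m) := by
  have h1 := card_commutator_le hp r m G hG hexp T hT hcl ⊤ inferInstance (by simpa using hm)
  rw [← commutator_def] at h1
  have h2 := card_closure_sup_le hp hexp (commutator G) le_rfl T
  rw [hcl, top_sup_eq, card_top] at h2
  calc Nat.card G ≤ p ^ r * p ^ (r * m) :=
        h2.trans (Nat.mul_le_mul (Nat.pow_le_pow_right hp.pos hT) h1)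
    _ = _ := by rw [pow_add]

/-- Order of an `r`-generated subgroup with central derived subgroup. -/
lemma card_class_two {p : ℕ} (hp : p.Prime) {G : Type u} [Group G] [Finite G]
    (hG : IsPGroup p G) (hexp : ∀ x : G, x ^ p = 1) (r : ℕ)
    (T : Finset G) (hT : T.card ≤ r) (hcl : closure (T : Set G) = ⊤)
    (hc : commutator G ≤ center G) : Nat.card G ≤ p ^ (r + r * r) := by
  refine card_le_of_center hp hG hexp r r T hT hcl ?_
  have h2 := card_closure_sup_le hp hexp (center G) hc T
  rw [hcl, top_sup_eq, card_top, ← index_mul_card (center G)] at h2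
  exact (Nat.le_of_mul_le_mul_right h2 Nat.card_pos).trans (Nat.pow_le_pow_right hp.pos hT)

/-- Index of the centralizer of a finite set. -/
lemma relIndex_centralizer_le {G : Type u} [Group G] [Finite G] (K : Subgroup G) (n : ℕ)
    (T : Finset G) (h : ∀ x ∈ T, (centralizer ({x} : Set G)).relIndex K ≤ n) :
    (centralizer (T : Set G)).relIndex K ≤ n ^ T.card := by
  classical
  induction T using Finset.induction_on with
  | empty =>
    have : centralizer ((∅ : Finset G) : Set G) = ⊤ := by
      rw [eq_top_iff]
      intro z _
      exact mem_centralizer_iff.2 (by simp)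
    rw [this]
    simp
  | insert x T hx ih =>
    have h1 : centralizer ({x} : Set G) ⊓ centralizer (T : Set G) ≤
        centralizer ((insert x T : Finset G) : Set G) := by
      intro z hz
      rw [mem_centralizer_iff]
      intro w hw
      rw [Finset.coe_insert] at hw
      rcases hw with rfl | hw
      · exact mem_centralizer_iff.1 hz.1 _ rfl
      · exact mem_centralizer_iff.1 hz.2 _ hw
    rw [Finset.card_insert_of_notMem hx, pow_succ']
    calc _ ≤ _ := relIndex_le_of_le_left h1 rel_ne_zero
      _ ≤ _ := relIndex_inf_le
      _ ≤ _ := Nat.mul_le_mul (h x (by simp)) (ih fun y hy => h y (by simp [hy]))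

/-- A Thompson-type critical subgroup. -/
lemma exists_critical {p : ℕ} (hp : p.Prime) {G : Type u} [Group G] [Finite G]
    (hG : IsPGroup p G) (α : MulAut G) :
    ∃ A K : Subgroup G, K.Normal ∧ (∀ k, α k ∈ K ↔ k ∈ K) ∧ A ≤ K ∧
      (∀ k ∈ K, ∀ g, ⁅k, g⁆ ∈ A) ∧ (∀ k ∈ K, ∀ a ∈ A, k * a = a * k) ∧
      centralizer (K : Set G) ≤ A := by
  classical
  let P : Subgroup G → Prop := fun A => A.Normal ∧ (∀ k, α k ∈ A ↔ k ∈ A) ∧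
    ∀ a ∈ A, ∀ b ∈ A, a * b = b * a
  have hPbot : P ⊥ := ⟨inferInstance, by simp, by simp⟩
  obtain ⟨A, hA⟩ := (Set.toFinite {A : Subgroup G | P A}).exists_maximal ⟨⊥, hPbot⟩
  obtain ⟨hAn, hAα, hAc⟩ : P A := hA.prop
  let K : Subgroup G := centralizer (A : Set G) ⊓ (center (G ⧸ A)).comap (QuotientGroup.mk' A)
  have hKmem : ∀ k, k ∈ K ↔ (∀ a ∈ A, k * a = a * k) ∧ ∀ g, ⁅k, g⁆ ∈ A := by
    intro k
    rw [mem_inf]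
    refine and_congr ?_ ?_
    · rw [mem_centralizer_iff]
      exact ⟨fun h a ha => (h a ha).symm, fun h a ha => (h a ha).symm⟩
    · rw [mem_comap, mem_center_iff]
      have : ∀ g, ⁅k, g⁆ ∈ A ↔
          QuotientGroup.mk' A g * QuotientGroup.mk' A k =
            QuotientGroup.mk' A k * QuotientGroup.mk' A g := by
        intro g
        rw [← QuotientGroup.eq_one_iff]
        change QuotientGroup.mk' A _ = 1 ↔ _
        rw [map_commutatorElement, commutatorElement_eq_one_iff_mul_comm]
        exact eq_comm
      constructor
      · intro h g
        exact (this g).2 (h _)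
      · intro h q
        obtain ⟨g, rfl⟩ := QuotientGroup.mk'_surjective A q
        exact (this g).1 (h g)
  have hAK : A ≤ K := by
    intro a ha
    rw [hKmem]
    refine ⟨fun b hb => hAc a ha b hb, fun g => ?_⟩
    rw [commutatorElement_def, mul_assoc, mul_assoc]
    refine mul_mem ha ?_
    rw [← mul_assoc]
    exact hAn.conj_mem _ (inv_mem ha) g
  have hKn : K.Normal := by
    have : (centralizer (A : Set G)).Normal := inferInstance
    have : ((center (G ⧸ A)).comap (QuotientGroup.mk' A)).Normal := inferInstance
    exact inferInstance
  have hKα : ∀ k, α k ∈ K ↔ k ∈ K := by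
    intro k
    rw [hKmem, hKmem]
    refine and_congr ?_ ?_
    · constructor
      · intro h a ha
        apply α.injective
        rw [map_mul, map_mul]
        exact h _ ((hAα a).2 ha)
      · intro h a ha
        obtain ⟨b, rfl⟩ := α.surjective a
        rw [← map_mul, ← map_mul, h b ((hAα b).1 ha)]
    · constructor
      · intro h g
        rw [← hAα, map_commutatorElement]
        exact h _
      · intro h g
        obtain ⟨b, rfl⟩ := α.surjective g
        rw [← map_commutatorElement, hAα]
        exact h b
  refine ⟨A, K, hKn, hKα, hAK, fun k hk => ((hKmem k).1 hk).2,
    fun k hk => ((hKmem k).1 hk).1, ?_⟩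
  -- the center of K is A
  have hcK : (centralizer (K : Set G)).Normal := inferInstance
  have hZ : K ⊓ centralizer (K : Set G) ≤ A := by
    have hPZ : P (K ⊓ centralizer (K : Set G)) := by
      refine ⟨inferInstance, ?_, ?_⟩
      · intro k
        rw [mem_inf (p := K), mem_inf (p := K), hKα]
        refine and_congr_right fun _ => ?_
        rw [mem_centralizer_iff, mem_centralizer_iff]
        constructor
        · intro h a ha
          apply α.injective
          rw [map_mul, map_mul]
          exact h _ ((hKα a).2 ha)
        · intro h a ha
          obtain ⟨b, rfl⟩ := α.surjective a
          rw [← map_mul, ← map_mul, h b ((hKα b).1 ha)]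
      · intro a ha b hb
        exact mem_centralizer_iff.1 hb.2 a ha.1
    refine hA.le_of_ge hPZ ?_
    intro a ha
    refine ⟨hAK ha, ?_⟩
    exact mem_centralizer_iff.2 fun k hk => ((hKmem k).1 hk).1 a ha
  by_contra hcon
  obtain ⟨y, hy, hyA, hyc⟩ := exists_central_mod hp hG A (centralizer (K : Set G)) hcon
  apply hyA
  apply hZ
  refine ⟨?_, hy⟩
  exact (hKmem y).2 ⟨fun a ha => (mem_centralizer_iff.1 hy a (hAK ha)).symm, hyc⟩

/-- The key index bound: a normal `α`-invariant `K` and an element of `I_G(α)`. -/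
lemma relIndex_centralizer_comm {G : Type u} [Group G] [Finite G] (α : MulAut G)
    (K : Subgroup G) [hK : K.Normal] (n : ℕ)
    (hn : Nat.card (closure {x : G | ∃ g ∈ K, x = g⁻¹ * α g}) ≤ n) (g : G) :
    (centralizer ({g⁻¹ * α g} : Set G)).relIndex K ≤ n * n := by
  let F : Subgroup G := (α.toMonoidHom).eqLocus (MonoidHom.id G)
  have hF : ∀ x, x ∈ F ↔ α x = x := fun x => Iff.rfl
  have h1 : F.relIndex K ≤ n := by
    refine le_trans ?_ hn
    change Nat.card (K ⧸ F.subgroupOf K) ≤ _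
    refine Nat.card_le_card_of_injective
      (fun q => ⟨((q.out : K) : G) * α ((q.out : K) : G)⁻¹,
        subset_closure ⟨((q.out : K) : G)⁻¹, inv_mem (q.out : K).2, by simp⟩⟩) ?_
    intro a b hab
    have hab' : ((a.out : K) : G) * α ((a.out : K) : G)⁻¹ =
        ((b.out : K) : G) * α ((b.out : K) : G)⁻¹ := congrArg Subtype.val hab
    rw [← a.out_eq', ← b.out_eq']
    refine QuotientGroup.eq.2 ?_
    rw [mem_subgroupOf, hF]
    push_cast
    rw [map_mul]
    rw [map_inv, map_inv] at *
    generalize ((a.out : K) : G) = u at *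
    generalize ((b.out : K) : G) = v at *
    have : α v = (α u) * u⁻¹ * v := by
      have h2 : (v * (α v)⁻¹)⁻¹ = (u * (α u)⁻¹)⁻¹ := by rw [hab']
      simp only [mul_inv_rev, inv_inv] at h2
      rw [← h2]; group
    rw [this]; group
  let c : G →* G := (MulAut.conj g).toMonoidHom
  have h2 : (F.comap c).relIndex K ≤ n := by
    rw [relIndex_comap]
    have : K.map c = K := Subgroup.Normal.map_conj_eq K g
    rwa [this]
  have h3 : F ⊓ F.comap c ≤ centralizer ({g⁻¹ * α g} : Set G) := by
    rintro k ⟨hk1, hk2⟩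
    rw [mem_centralizer_singleton_iff]
    have e1 : α k = k := hk1
    have e2 : α (g * k * g⁻¹) = g * k * g⁻¹ := hk2
    simp only [map_mul, map_inv, e1] at e2
    have e3 : α g * k = g * k * g⁻¹ * α g := by rw [← e2]; group
    rw [mul_assoc g⁻¹, e3]; group
  calc _ ≤ _ := relIndex_le_of_le_left h3 rel_ne_zero
    _ ≤ _ := relIndex_inf_le
    _ ≤ _ := Nat.mul_le_mul h1 h2

lemma index_centralizer_le {G : Type u} [Group G] [Finite G] (K : Subgroup G) (k : G)
    (hk : k ∈ K) :
    (centralizer ({k} : Set G)).index ≤ Nat.card (⁅K, (⊤ : Subgroup G)⁆ : Subgroup G) := by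
  change Nat.card (G ⧸ _) ≤ _
  refine Nat.card_le_card_of_injective (fun q => ⟨⁅q.out, k⁆, ?_⟩) ?_
  · rw [commutator_comm]
    exact commutator_mem_commutator (mem_top _) hk
  · intro a b hab
    have hab' : ⁅a.out, k⁆ = ⁅b.out, k⁆ := congrArg Subtype.val hab
    rw [← a.out_eq', ← b.out_eq']
    refine QuotientGroup.eq.2 ?_
    rw [mem_centralizer_singleton_iff]
    generalize a.out = u at *
    generalize b.out = v at *
    simp only [commutatorElement_def] at hab'
    have h2 : u * k * u⁻¹ = v * k * v⁻¹ := mul_right_cancel hab'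
    have h3 : v * k = u * k * u⁻¹ * v := by rw [h2]; group
    have h4 : k * u⁻¹ * v = u⁻¹ * (v * k) := by rw [h3]; group
    simp only [← mul_assoc] at h4 ⊢
    exact h4.symm

/-- The order bound. -/
lemma card_bound {p : ℕ} (hp : p.Prime) {G : Type u} [Group G] [Finite G]
    (hG : IsPGroup p G) (hexp : ∀ x : G, x ^ p = 1) (α : MulAut G) (r : ℕ)
    (htop : closure {x : G | ∃ g : G, x = g⁻¹ * α g} = ⊤)
    (hgen : ∀ S : Set G, S ⊆ {x : G | ∃ g : G, x = g⁻¹ * α g} →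
      ∃ T : Finset G, T.card ≤ r ∧ closure (T : Set G) = closure S)
    (t s m : ℕ) (ht : t = r + r * r) (hs : s = (t + t) * r) (hm : m = s + r * s * s) :
    Nat.card G ≤ p ^ (r + r * m) := by
  -- choose generators in I
  obtain ⟨T, hTI, hTr, hTtop⟩ : ∃ T : Finset G, (T : Set G) ⊆ {x : G | ∃ g : G, x = g⁻¹ * α g} ∧
      T.card ≤ r ∧ closure (T : Set G) = ⊤ := by
    obtain ⟨T0, hT0, hcl0⟩ := hgen _ subset_rfl
    rw [htop] at hcl0
    have h1 := card_closure_sup_le hp hexp (commutator G) le_rfl T0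
    rw [hcl0, top_sup_eq] at h1
    obtain ⟨T, hTI, hT1, hT2⟩ := greedy hp hG (commutator G) {x : G | ∃ g : G, x = g⁻¹ * α g}
    rw [htop, top_sup_eq] at hT1 hT2
    refine ⟨T, hTI, ?_, closure_eq_top hp hG _ hT1⟩
    have h3 := Nat.le_of_mul_le_mul_right (hT2.trans h1) Nat.card_pos
    exact ((Nat.pow_le_pow_iff_right hp.one_lt).1 h3).trans hT0
  refine card_le_of_center hp hG hexp r m T hTr hTtop ?_
  obtain ⟨A, K, hKn, hKα, hAK, hKA, hAc, hcent⟩ := exists_critical hp hG α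
  have hJ : Nat.card (closure {x : G | ∃ g ∈ K, x = g⁻¹ * α g}) ≤ p ^ t := by
    obtain ⟨T1, hT1, hcl1⟩ := hgen {x : G | ∃ g ∈ K, x = g⁻¹ * α g}
      (by rintro x ⟨g, -, rfl⟩; exact ⟨g, rfl⟩)
    have hJK : closure {x : G | ∃ g ∈ K, x = g⁻¹ * α g} ≤ K := by
      rw [closure_le]
      rintro x ⟨g, hg, rfl⟩
      exact mul_mem (inv_mem hg) ((hKα g).2 hg)
    rw [← hcl1] at hJK ⊢
    classical
    rw [ht]
    refine card_class_two hp (hG.to_subgroup _) (fun x => Subtype.ext (by simpa using hexp x)) r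
      (T1.subtype (· ∈ closure (T1 : Set G))) ?_ ?_ ?_
    · rw [Finset.card_subtype]
      exact (Finset.card_filter_le _ _).trans hT1
    · have := closure_closure_coe_preimage (k := (T1 : Set G))
      convert this using 2
      ext x
      simp
    · rw [commutator_def, commutator_le]
      intro a _ b _
      rw [mem_center_iff]
      intro c
      ext
      exact hAc c (hJK c.2) _ (hKA a (hJK a.2) b)
  have hKZ : (center G).relIndex K ≤ p ^ s := by
    have h1 := relIndex_centralizer_le K (p ^ t * p ^ t) T (by
      intro x hx
      obtain ⟨g, rfl⟩ := hTI hx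
      exact relIndex_centralizer_comm α K _ hJ g)
    have h2 : centralizer (T : Set G) = center G := by
      rw [← centralizer_closure, hTtop, coe_top, centralizer_univ]
    rw [h2] at h1
    refine h1.trans ?_
    rw [hs, ← pow_add, ← pow_mul]
    exact Nat.pow_le_pow_right hp.pos (Nat.mul_le_mul_left _ hTr)
  have hZC : center G ≤ centralizer (K : Set G) := center_le_centralizer _
  have hZK : center G ≤ K := hZC.trans (hcent.trans hAK)
  have hcom := card_commutator_le hp r s G hG hexp T hTr hTtop K hKn hKZ
  have hC : (centralizer (K : Set G)).index ≤ p ^ (r * s * s) := by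
    obtain ⟨T2, hT2K, hT2, hT2c⟩ := greedy hp hG (center G) (K : Set G)
    rw [closure_eq, sup_eq_left.2 hZK] at hT2 hT2c
    have hT2s : T2.card ≤ s := by
      rw [← rel_mul_card _ _ hZK] at hT2c
      have := (Nat.le_of_mul_le_mul_right hT2c Nat.card_pos).trans hKZ
      exact (Nat.pow_le_pow_iff_right hp.one_lt).1 this
    have h1 := relIndex_centralizer_le ⊤ (p ^ (r * s)) T2 (by
      intro x hx
      rw [relIndex_top_right]
      exact (index_centralizer_le K x (hT2K hx)).trans hcom)
    rw [relIndex_top_right] at h1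
    have h2 : centralizer (T2 : Set G) ≤ centralizer (K : Set G) := by
      intro z hz
      have h3 : K ≤ centralizer ({z} : Set G) := by
        rw [← hT2]
        refine sup_le ((closure_le _).2 ?_) (center_le_centralizer _)
        intro x hx
        rw [SetLike.mem_coe, mem_centralizer_singleton_iff]
        exact mem_centralizer_iff.1 hz x hx
      rw [mem_centralizer_iff]
      intro k hk
      exact mem_centralizer_singleton_iff.1 (h3 hk)
    refine (index_antitone h2).trans (h1.trans ?_)
    rw [← pow_mul]
    exact Nat.pow_le_pow_right hp.pos (Nat.mul_le_mul_left _ hT2s)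
  rw [← relIndex_mul_index hZC, hm, pow_add]
  refine Nat.mul_le_mul ?_ hC
  exact (relIndex_le_of_le_right (hcent.trans hAK) rel_ne_zero).trans hKZ

end RankExp

/-- Lemma 4.3: There is `l : ℕ → ℕ` such that if a finite `p`-group `G` of exponent `p`
admits a coprime automorphism `α` with `G = [G,α]` and every subgroup generated by a
subset of `I_G(α)` can be generated by at most `r` elements, then the rank of `G` is at
most `l r`. -/
theorem rank_bounded_exponent_p :
    ∃ l : ℕ → ℕ,
      ∀ (p : ℕ), p.Prime →
      ∀ (G : Type*) [Group G] [Finite G], IsPGroup p G →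
        (∀ x : G, x ^ p = 1) →
        ∀ (α : MulAut G) (r : ℕ),
          Nat.Coprime (orderOf α) (Nat.card G) →
          Subgroup.closure {x : G | ∃ g : G, x = g⁻¹ * α g} = ⊤ →
          (∀ S : Set G, S ⊆ {x : G | ∃ g : G, x = g⁻¹ * α g} →
            ∃ T : Finset G, T.card ≤ r ∧
              Subgroup.closure (T : Set G) = Subgroup.closure S) →
          ∀ H : Subgroup G,
            ∃ T : Finset G, T.card ≤ l r ∧ Subgroup.closure (T : Set G) = H := by
  let t : ℕ → ℕ := fun r => r + r * r
  let s : ℕ → ℕ := fun r => (t r + t r) * r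
  let m : ℕ → ℕ := fun r => s r + r * s r * s r
  refine ⟨fun r => r + r * m r, ?_⟩
  intro p hp G _ _ hG hexp α r _ htop hgen H
  have hcard := RankExp.card_bound hp hG hexp α r htop hgen (t r) (s r) (m r) rfl rfl rfl
  obtain ⟨T, -, hT, hTc⟩ := RankExp.greedy hp hG ⊥ (H : Set G)
  rw [Subgroup.closure_eq, sup_bot_eq, sup_bot_eq] at hT
  rw [Subgroup.closure_eq, sup_bot_eq, Subgroup.card_bot, mul_one] at hTc
  refine ⟨T, ?_, hT⟩
  have h1 : p ^ T.card ≤ p ^ (r + r * m r) :=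
    hTc.trans ((Subgroup.card_le_card_group H).trans hcard)
  exact (Nat.pow_le_pow_iff_right hp.one_lt).1 h1
end

section
/- There exists a function f : ℕ → ℕ such that the following holds. Let p be a prime and G a finite p-group admitting an automorphism α whose order is coprime to |G|, with G = [G,α]. Suppose that every subgroup of G generated by a subset of I_G(α) can be generated by at most r elements. Then every subgroup of G can be generated by at most f(r) elements; that is, the rank of G is r-bounded. -/
namespace RBP

open scoped commutatorElement

/-- The subgroup generated by the `n`-th powers of elements of `H`. -/
def pw {G : Type*} [Group G] (n : ℕ) (H : Subgroup G) : Subgroup G :=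
  Subgroup.closure {y | ∃ x ∈ H, y = x ^ n}

theorem card_closure_le_comm {A : Type*} [CommGroup A] [Finite A] (n : ℕ) (hn : 0 < n)
    (hexp : ∀ x : A, x ^ n = 1) (T : Finset A) :
    Nat.card (Subgroup.closure (T : Set A)) ≤ n ^ T.card := by
  classical
  induction T using Finset.induction_on with
  | empty => simp
  | insert t T ht ih =>
    rw [Finset.card_insert_of_notMem ht, Finset.coe_insert, Set.insert_eq, Subgroup.closure_union,
      ← Subgroup.zpowers_eq_closure]
    set K := Subgroup.closure (T : Set A)
    have h1 : Nat.card K * K.relIndex (Subgroup.zpowers t ⊔ K)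
        = Nat.card (Subgroup.zpowers t ⊔ K : Subgroup A) := by
      rw [← Subgroup.relIndex_bot_left, ← Subgroup.relIndex_bot_left]
      exact Subgroup.relIndex_mul_relIndex _ _ _ bot_le le_sup_right
    rw [← h1, Subgroup.relIndex_sup_right]
    have h2 : K.relIndex (Subgroup.zpowers t) ≤ n := by
      refine (Nat.le_of_dvd Nat.card_pos (Subgroup.relIndex_dvd_card _ _)).trans ?_
      rw [Nat.card_zpowers]
      exact orderOf_le_of_pow_eq_one hn (hexp t)
    rw [pow_succ]
    exact Nat.mul_le_mul ih h2

theorem card_closure_le {G : Type*} [Group G] [Finite G] (n : ℕ) (hn : 0 < n)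
    (T : Finset G) (hc : ∀ x ∈ Subgroup.closure (T : Set G), ∀ y ∈ Subgroup.closure (T : Set G),
      x * y = y * x)
    (hexp : ∀ x ∈ Subgroup.closure (T : Set G), x ^ n = 1) :
    Nat.card (Subgroup.closure (T : Set G)) ≤ n ^ T.card := by
  classical
  set C := Subgroup.closure (T : Set G) with hC
  let _ : CommGroup C := { (inferInstance : Group C) with
    mul_comm := fun a b => Subtype.ext (hc a a.2 b b.2) }
  let T' : Finset C := T.preimage Subtype.val Subtype.val_injective.injOn
  have h1 : Subgroup.closure (T' : Set C) = ⊤ := by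
    have := Subgroup.closure_closure_coe_preimage (k := (T : Set G))
    rw [Finset.coe_preimage]; exact this
  have h2 := card_closure_le_comm n hn (fun x : C => Subtype.ext (hexp x x.2)) T'
  rw [h1, Subgroup.card_top] at h2
  refine h2.trans (Nat.pow_le_pow_right hn ?_)
  exact Finset.card_le_card_of_injOn Subtype.val (fun x hx => by simpa [T'] using hx)
    Subtype.val_injective.injOn

theorem coatom_index {p : ℕ} [Fact p.Prime] {G : Type*} [Group G] [Finite G] (hG : IsPGroup p G)
    {M : Subgroup G} (hM : IsCoatom M) : M.index = p := by
  obtain ⟨n, hn⟩ := IsPGroup.iff_card.1 (hG.to_subgroup M)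
  obtain ⟨m, hm⟩ := hG.index M
  have hc := M.card_mul_index
  have hm0 : m ≠ 0 := by
    rintro rfl
    exact hM.1 (Subgroup.index_eq_one.1 (by simpa using hm))
  have hd : p ^ (n + 1) ∣ Nat.card G := by
    rw [← hc, hn, hm, ← pow_add]; exact pow_dvd_pow _ (by omega)
  obtain ⟨K, hK, hMK⟩ := Sylow.exists_subgroup_card_pow_succ hd hn
  have hlt : M < K := lt_of_le_of_ne hMK (by
    rintro rfl
    rw [hn] at hK
    have := Nat.pow_right_injective (Fact.out : p.Prime).two_le hK
    omega)
  have hKt := hM.2 K hlt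
  rw [hKt, Subgroup.card_top] at hK
  rw [hK, hn, pow_succ] at hc
  exact Nat.eq_of_mul_eq_mul_left (pow_pos (Fact.out : p.Prime).pos n) hc

theorem coatom_normal {p : ℕ} [Fact p.Prime] {G : Type*} [Group G] [Finite G] (hG : IsPGroup p G)
    {M : Subgroup G} (hM : IsCoatom M) : M.Normal := by
  have := hG.isNilpotent
  exact Subgroup.NormalizerCondition.normal_of_coatom M Group.normalizerCondition_of_isNilpotent hM

theorem mem_frattini {G : Type*} [Group G] (x : G) (h : ∀ M : Subgroup G, IsCoatom M → x ∈ M) :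
    x ∈ frattini G := by
  simp only [frattini, Order.radical, Subgroup.mem_iInf]
  exact h

theorem pow_mem_frattini {p : ℕ} [Fact p.Prime] {G : Type*} [Group G] [Finite G]
    (hG : IsPGroup p G) (x : G) : x ^ p ∈ frattini G := by
  refine mem_frattini _ fun M hM => ?_
  have := coatom_normal hG hM
  have := M.pow_index_mem x
  rwa [coatom_index hG hM] at this

theorem commutator_le_frattini {p : ℕ} [Fact p.Prime] {G : Type*} [Group G] [Finite G]
    (hG : IsPGroup p G) (x y : G) : ⁅x, y⁆ ∈ frattini G := by
  refine mem_frattini _ fun M hM => ?_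
  have := coatom_normal hG hM
  have h1 : Nat.card (G ⧸ M) = p := by rw [← Subgroup.index_eq_card, coatom_index hG hM]
  have := isCyclic_of_prime_card h1
  let _ : CommGroup (G ⧸ M) := IsCyclic.commGroup
  rw [← QuotientGroup.eq_one_iff]
  change QuotientGroup.mk' M ⁅x, y⁆ = 1
  rw [map_commutatorElement]
  exact commutatorElement_eq_one_iff_mul_comm.2 (mul_comm _ _)

theorem card_lt_step {p : ℕ} [Fact p.Prime] {G : Type*} [Group G] [Finite G]
    (hG : IsPGroup p G) {H K : Subgroup G} (h : H < K) : p * Nat.card H ≤ Nat.card K := by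
  obtain ⟨a, ha⟩ := IsPGroup.iff_card.1 (hG.to_subgroup H)
  obtain ⟨b, hb⟩ := IsPGroup.iff_card.1 (hG.to_subgroup K)
  have hp := (Fact.out : p.Prime)
  have hlt : Nat.card H < Nat.card K := by
    have h1 := Subgroup.card_le_of_le h.le
    refine lt_of_le_of_ne h1 fun he => h.ne (Subgroup.eq_of_le_of_card_ge h.le he.ge)
  rw [ha, hb] at *
  have : a < b := (Nat.pow_lt_pow_iff_right hp.one_lt).1 hlt
  rw [← pow_succ']
  exact Nat.pow_le_pow_right hp.pos this

/-- Burnside basis theorem, greedy form. -/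
theorem burnside {p : ℕ} [Fact p.Prime] {G : Type*} [Group G] [Finite G]
    (hG : IsPGroup p G) (d : ℕ) (hd : Nat.card G ≤ p ^ d * Nat.card (frattini G)) (S : Set G)
    (hS : Subgroup.closure S = ⊤) :
    ∃ T : Finset G, (T : Set G) ⊆ S ∧ T.card ≤ d ∧ Subgroup.closure (T : Set G) = ⊤ := by
  classical
  have key : ∀ n : ℕ, ∃ T : Finset G, (T : Set G) ⊆ S ∧ T.card ≤ n ∧
      (Subgroup.closure (T : Set G) ⊔ frattini G = ⊤ ∨
        p ^ n * Nat.card (frattini G) ≤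
          Nat.card (Subgroup.closure (T : Set G) ⊔ frattini G : Subgroup G)) := by
    intro n
    induction n with
    | zero => exact ⟨∅, by simp, by simp, Or.inr (by simp)⟩
    | succ n ih =>
      obtain ⟨T, hTS, hTn, h⟩ := ih
      by_cases htop : Subgroup.closure (T : Set G) ⊔ frattini G = ⊤
      · exact ⟨T, hTS, by omega, Or.inl htop⟩
      have h := h.resolve_left htop
      obtain ⟨s, hs, hsT⟩ : ∃ s ∈ S, s ∉ Subgroup.closure (T : Set G) ⊔ frattini G := by
        by_contra! hcon
        apply htop
        rw [eq_top_iff, ← hS, Subgroup.closure_le]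
        exact hcon
      refine ⟨insert s T, ?_, (Finset.card_insert_le _ _).trans (by omega), Or.inr ?_⟩
      · rw [Finset.coe_insert]; exact Set.insert_subset hs hTS
      · have hlt : Subgroup.closure (T : Set G) ⊔ frattini G <
            Subgroup.closure ((insert s T : Finset G) : Set G) ⊔ frattini G := by
          refine lt_of_le_of_ne (sup_le_sup_right (Subgroup.closure_mono (by simp)) _) ?_
          intro he
          apply hsT
          rw [he]
          exact Subgroup.mem_sup_left (Subgroup.subset_closure (by simp))
        have := card_lt_step hG hlt
        calc _ = p * (p ^ n * Nat.card (frattini G)) := by ring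
          _ ≤ _ := Nat.mul_le_mul_left _ h
          _ ≤ _ := this
  obtain ⟨T, hTS, hTn, h⟩ := key d
  refine ⟨T, hTS, hTn, frattini_nongenerating ?_⟩
  rcases h with h | h
  · exact h
  · exact Subgroup.eq_top_of_le_card _ (hd.trans h)

/-- a `d`-generated `p`-group has Frattini quotient of order at most `p ^ d`. -/
theorem card_le_frattini {p : ℕ} [Fact p.Prime] {G : Type*} [Group G] [Finite G]
    (hG : IsPGroup p G) (T : Finset G) (hT : Subgroup.closure (T : Set G) = ⊤) :
    Nat.card G ≤ p ^ T.card * Nat.card (frattini G) := by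
  classical
  have hp := (Fact.out : p.Prime)
  let f := QuotientGroup.mk' (frattini G)
  have hf : Function.Surjective f := QuotientGroup.mk'_surjective _
  have h1 : Subgroup.closure ((T.image f : Finset _) : Set (G ⧸ frattini G)) = ⊤ := by
    rw [Finset.coe_image, ← MonoidHom.map_closure, hT, Subgroup.map_top_of_surjective _ hf]
  have h2 := card_closure_le p hp.pos (T.image f) (by
    intro x _ y _
    obtain ⟨x, rfl⟩ := hf x
    obtain ⟨y, rfl⟩ := hf y
    rw [← commutatorElement_eq_one_iff_mul_comm, ← map_commutatorElement]
    exact (QuotientGroup.eq_one_iff _).2 (commutator_le_frattini hG x y)) (by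
    intro x _
    obtain ⟨x, rfl⟩ := hf x
    rw [← map_pow]
    exact (QuotientGroup.eq_one_iff _).2 (pow_mem_frattini hG x))
  rw [h1, Subgroup.card_top] at h2
  rw [← Subgroup.index_mul_card (frattini G), Subgroup.index_eq_card]
  exact Nat.mul_le_mul_right _ (h2.trans (Nat.pow_le_pow_right hp.pos Finset.card_image_le))

theorem exists_gen {p : ℕ} [Fact p.Prime] {G : Type*} [Group G] [Finite G]
    (hG : IsPGroup p G) (H P : Subgroup G) (d : ℕ)
    (hP : P ≤ pw p H)
    (hd : Nat.card H ≤ p ^ d * Nat.card P) :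
    ∃ T : Finset G, T.card ≤ d ∧ Subgroup.closure (T : Set G) = H := by
  classical
  have hH := hG.to_subgroup H
  have hle : P ≤ (frattini H).map H.subtype := by
    refine hP.trans ?_
    rw [pw, Subgroup.closure_le]
    rintro y ⟨x, hx, rfl⟩
    exact ⟨⟨x, hx⟩ ^ p, pow_mem_frattini hH _, rfl⟩
  have hc : Nat.card P ≤ Nat.card (frattini H) := by
    refine (Subgroup.card_le_of_le hle).trans ?_
    exact Nat.le_of_dvd Nat.card_pos (Subgroup.card_map_dvd _ _)
  obtain ⟨T, -, hT, hTt⟩ := burnside hH d (hd.trans (Nat.mul_le_mul_left _ hc)) Set.univ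
    (by simp)
  refine ⟨T.image H.subtype, Finset.card_image_le.trans hT, ?_⟩
  rw [Finset.coe_image, ← MonoidHom.map_closure, hTt, ← MonoidHom.range_eq_map,
    Subgroup.range_subtype]

end RBP
namespace RBP

open scoped commutatorElement

theorem pow_mem_pw {G : Type*} [Group G] {n : ℕ} {H : Subgroup G} {x : G} (hx : x ∈ H) :
    x ^ n ∈ pw n H := Subgroup.subset_closure ⟨x, hx, rfl⟩

theorem pw_le_iff {G : Type*} [Group G] {n : ℕ} {H K : Subgroup G} :
    pw n H ≤ K ↔ ∀ x ∈ H, x ^ n ∈ K := by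
  rw [pw, Subgroup.closure_le]
  constructor
  · intro h x hx; exact h ⟨x, hx, rfl⟩
  · rintro h y ⟨x, hx, rfl⟩; exact h x hx

theorem pw_le {G : Type*} [Group G] {n : ℕ} {H : Subgroup G} : pw n H ≤ H :=
  pw_le_iff.2 fun _ hx => H.pow_mem hx n

theorem pw_mono {G : Type*} [Group G] {n : ℕ} {H K : Subgroup G} (h : H ≤ K) :
    pw n H ≤ pw n K := pw_le_iff.2 fun _ hx => pow_mem_pw (h hx)

theorem pw_sq_le {G : Type*} [Group G] {p : ℕ} {H : Subgroup G} :
    pw (p ^ 2) H ≤ pw p (pw p H) := pw_le_iff.2 fun x hx => by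
  rw [sq, pow_mul]
  exact pow_mem_pw (pow_mem_pw hx)

theorem pw_normal {G : Type*} [Group G] {n : ℕ} {H : Subgroup G} (hH : H.Normal) :
    (pw n H).Normal := by
  refine ⟨fun y hy g => ?_⟩
  have h : pw n H ≤ (pw n H).comap (MulAut.conj g).toMonoidHom := by
    rw [pw_le_iff]
    intro x hx
    have := pow_mem_pw (n := n) (hH.conj_mem x hx g)
    rw [conj_pow] at this
    exact this
  exact h hy

theorem pw_inv {G : Type*} [Group G] {n : ℕ} {H : Subgroup G} {α : G →* G}
    (hH : H ≤ H.comap α) : pw n H ≤ (pw n H).comap α := by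
  rw [pw_le_iff]
  intro x hx
  rw [Subgroup.mem_comap, map_pow]
  exact pow_mem_pw (hH hx)

theorem pw_lt {p : ℕ} [Fact p.Prime] {G : Type*} [Group G] [Finite G]
    (hG : IsPGroup p G) (N : Subgroup G) (hN : N ≠ ⊥) : pw p N < N := by
  refine lt_of_le_of_ne pw_le fun he => hN ?_
  have h1 : N ≤ (frattini N).map N.subtype := by
    conv_lhs => rw [← he]
    rw [pw_le_iff]
    intro x hx
    exact ⟨⟨x, hx⟩ ^ p, pow_mem_frattini (hG.to_subgroup N) _, rfl⟩
  have h2 : frattini N = ⊤ := by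
    rw [eq_top_iff]
    intro x _
    obtain ⟨y, hy, hyx⟩ := h1 x.2
    have : y = x := Subtype.ext hyx
    exact this ▸ hy
  have h3 : (⊥ : Subgroup N) = ⊤ := frattini_nongenerating (by rw [h2]; simp)
  rw [eq_bot_iff]
  intro x hx
  have : (⟨x, hx⟩ : N) ∈ (⊥ : Subgroup N) := by rw [h3]; trivial
  simpa using this

theorem card_inf_mul {G : Type*} [Group G] (H K : Subgroup G) :
    Nat.card (H ⊓ K : Subgroup G) * H.relIndex K = Nat.card K := by
  rw [← Subgroup.inf_relIndex_right, ← Subgroup.relIndex_bot_left, ← Subgroup.relIndex_bot_left]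
  exact Subgroup.relIndex_mul_relIndex _ _ _ bot_le inf_le_right

theorem card_subgroupOf {G : Type*} [Group G] (H K : Subgroup G) :
    Nat.card (H.subgroupOf K) = Nat.card (H ⊓ K : Subgroup G) := by
  rw [← Subgroup.subgroupOf_map_subtype]
  exact (Nat.card_congr ((H.subgroupOf K).equivMapOfInjective K.subtype
    K.subtype_injective).toEquiv)

theorem chain_step {p : ℕ} {G : Type*} [Group G] [Finite G]
    {W0 W1 W2 H : Subgroup G} (hn : W2.Normal) (e1 : W1 = pw p W0) (e2 : W2 = pw p W1)
    (hc : ⁅W0, W0⁆ ≤ W2)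
    (hH : Nat.card (H ⊓ W1 : Subgroup G) * Nat.card W2 ≤
      Nat.card (pw p H ⊓ W2 : Subgroup G) * Nat.card W1) :
    Nat.card (H ⊓ W0 : Subgroup G) * Nat.card W1 ≤
      Nat.card (pw p H ⊓ W1 : Subgroup G) * Nat.card W0 := by
  have l10 : W1 ≤ W0 := e1 ▸ pw_le
  have l21 : W2 ≤ W1 := e2 ▸ pw_le
  let φ : W0 →* G ⧸ W2 :=
    { toFun := fun x => QuotientGroup.mk' W2 ((x : G) ^ p)
      map_one' := by simp
      map_mul' := by
        intro x y
        have hxy : Commute (QuotientGroup.mk' W2 (x : G)) (QuotientGroup.mk' W2 (y : G)) := by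
          rw [← commutatorElement_eq_one_iff_commute, ← map_commutatorElement]
          exact (QuotientGroup.eq_one_iff _).2
            (hc (Subgroup.commutator_mem_commutator x.2 y.2))
        rw [map_pow, map_pow, map_pow, Subgroup.coe_mul, map_mul, hxy.mul_pow] }
  have hφ : ∀ x, φ x = QuotientGroup.mk' W2 ((x : G) ^ p) := fun _ => rfl
  set K := φ.ker
  set L := H.subgroupOf W0
  set M := W1.subgroupOf W0
  have hMK : M ≤ K := by
    intro x hx
    rw [MonoidHom.mem_ker, hφ]
    refine (QuotientGroup.eq_one_iff _).2 ?_
    rw [e2]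
    exact pow_mem_pw (Subgroup.mem_subgroupOf.1 hx)
  have c1 : Nat.card (L ⊓ K : Subgroup W0) * Nat.card (L.map φ) = Nat.card L := by
    rw [← Subgroup.relIndex_ker, inf_comm]; exact card_inf_mul K L
  have hq : ∀ X : Subgroup G, Nat.card (W2 ⊓ X : Subgroup G) *
      Nat.card (X.map (QuotientGroup.mk' W2)) = Nat.card X := by
    intro X
    rw [← Subgroup.relIndex_ker, QuotientGroup.ker_mk']; exact card_inf_mul W2 X
  have c2 : Nat.card (L.map φ) * Nat.card (pw p H ⊓ W2 : Subgroup G) ≤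
      Nat.card (pw p H ⊓ W1 : Subgroup G) := by
    have hle : L.map φ ≤ (pw p H ⊓ W1).map (QuotientGroup.mk' W2) := by
      rintro _ ⟨x, hx, rfl⟩
      exact ⟨(x : G) ^ p, ⟨pow_mem_pw (Subgroup.mem_subgroupOf.1 hx),
        e1 ▸ pow_mem_pw x.2⟩, rfl⟩
    have h1 := hq (pw p H ⊓ W1)
    have h2 : W2 ⊓ (pw p H ⊓ W1) = pw p H ⊓ W2 := by
      rw [inf_comm, inf_assoc, inf_eq_right.2 l21]
    rw [h2] at h1
    rw [← h1, mul_comm]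
    exact Nat.mul_le_mul_left _ (Subgroup.card_le_of_le hle)
  have c3 : Nat.card K * Nat.card W1 = Nat.card W0 * Nat.card W2 := by
    have hr : φ.range = W1.map (QuotientGroup.mk' W2) := by
      apply le_antisymm
      · rintro _ ⟨x, rfl⟩
        exact ⟨(x : G) ^ p, e1 ▸ pow_mem_pw x.2, rfl⟩
      · rw [Subgroup.map_le_iff_le_comap, e1, pw_le_iff]
        intro x hx
        exact ⟨⟨x, hx⟩, rfl⟩
    have h1 := Subgroup.card_mul_index K
    rw [Subgroup.index_ker, hr] at h1
    have h2 := hq W1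
    rw [inf_eq_left.2 l21] at h2
    rw [← h1, ← h2]; ring
  have c4 : Nat.card (L ⊓ K : Subgroup W0) * Nat.card W1 ≤
      Nat.card K * Nat.card (H ⊓ W1 : Subgroup G) := by
    have h1 := card_inf_mul M (L ⊓ K)
    have h2 := card_inf_mul M K
    have h3 : M ⊓ (L ⊓ K) = (H ⊓ W1).subgroupOf W0 := by
      rw [inf_comm, inf_assoc, inf_eq_right.2 hMK]; rfl
    rw [h3, card_subgroupOf, inf_eq_left.2 (inf_le_right.trans l10)] at h1
    rw [inf_eq_left.2 hMK, card_subgroupOf, inf_eq_left.2 l10] at h2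
    have h4 : M.relIndex (L ⊓ K) ≤ M.relIndex K :=
      Subgroup.relIndex_le_of_le_right inf_le_right (Subgroup.index_ne_zero_of_finite)
    rw [← h1, ← h2]
    calc _ = (Nat.card (H ⊓ W1 : Subgroup G) * Nat.card W1) * M.relIndex (L ⊓ K) := by ring
      _ ≤ (Nat.card (H ⊓ W1 : Subgroup G) * Nat.card W1) * M.relIndex K :=
        Nat.mul_le_mul_left _ h4
      _ = _ := by ring
  rw [← card_subgroupOf H W0]
  change Nat.card L * _ ≤ _
  rw [← c1]
  have hP2 : 0 < Nat.card (pw p H ⊓ W2 : Subgroup G) := Nat.card_pos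
  have hw2 : 0 < Nat.card W2 := Nat.card_pos
  generalize Nat.card (L ⊓ K : Subgroup W0) = a at *
  generalize Nat.card (L.map φ) = b at *
  generalize Nat.card (pw p H ⊓ W2 : Subgroup G) = P2 at *
  generalize Nat.card (pw p H ⊓ W1 : Subgroup G) = P1 at *
  generalize Nat.card (H ⊓ W1 : Subgroup G) = h1 at *
  generalize Nat.card K = k at *
  generalize Nat.card W0 = w0 at *
  generalize Nat.card W1 = w1 at *
  generalize Nat.card W2 = w2 at *
  refine Nat.le_of_mul_le_mul_right ?_ (Nat.mul_pos hP2 hw2)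
  calc a * b * w1 * (P2 * w2) = (a * w1) * (b * P2) * w2 := by ring
    _ ≤ (k * h1) * P1 * w2 := Nat.mul_le_mul_right _ (Nat.mul_le_mul c4 c2)
    _ = k * P1 * (h1 * w2) := by ring
    _ ≤ k * P1 * (P2 * w1) := Nat.mul_le_mul_left _ hH
    _ = (k * w1) * P1 * P2 := by ring
    _ = (w0 * w2) * P1 * P2 := by rw [c3]
    _ = _ := by ring

theorem iter_bot {p : ℕ} [Fact p.Prime] {G : Type*} [Group G] [Finite G]
    (hG : IsPGroup p G) (N : Subgroup G) : ∃ n, (pw p)^[n] N = ⊥ := by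
  by_contra! h
  have key : ∀ n, Nat.card ((pw p)^[n] N) + n ≤ Nat.card N := by
    intro n
    induction n with
    | zero => simp
    | succ n ih =>
      rw [Function.iterate_succ_apply']
      have h1 := card_lt_step hG (pw_lt hG _ (h n))
      have h2 : 2 * Nat.card (pw p ((pw p)^[n] N)) ≤ p * Nat.card (pw p ((pw p)^[n] N)) :=
        Nat.mul_le_mul_right _ (Fact.out : p.Prime).two_le
      have h3 : 0 < Nat.card (pw p ((pw p)^[n] N)) := Nat.card_pos
      omega
  have h1 := key (Nat.card N)
  have h3 : 0 < Nat.card ((pw p)^[Nat.card N] N) := Nat.card_pos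
  omega

/-- If the commutators go two steps down along the power series of `N`, then every subgroup of
`N` is generated by `R` elements, where `|N : N^p| ≤ p ^ R`. -/
theorem chain_gen {p : ℕ} [Fact p.Prime] {G : Type*} [Group G] [Finite G]
    (hG : IsPGroup p G) (N : Subgroup G) (hN : N.Normal)
    (hc : ∀ i, ⁅(pw p)^[i] N, (pw p)^[i] N⁆ ≤ (pw p)^[i + 2] N) (R : ℕ)
    (hR : Nat.card N ≤ p ^ R * Nat.card (pw p N)) (H : Subgroup G) (hH : H ≤ N) :
    ∃ T : Finset G, T.card ≤ R ∧ Subgroup.closure (T : Set G) = H := by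
  have hnorm : ∀ i, ((pw p)^[i] N).Normal := by
    intro i
    induction i with
    | zero => exact hN
    | succ n ih => rw [Function.iterate_succ_apply']; exact pw_normal ih
  obtain ⟨n, hn⟩ := iter_bot hG N
  have key : ∀ j i, i + j = n →
      Nat.card (H ⊓ (pw p)^[i] N : Subgroup G) * Nat.card ((pw p)^[i + 1] N) ≤
      Nat.card (pw p H ⊓ (pw p)^[i + 1] N : Subgroup G) * Nat.card ((pw p)^[i] N) := by
    intro j
    induction j with
    | zero =>
      intro i hi
      obtain rfl : i = n := by omega
      have h1 : (pw p)^[i + 1] N = ⊥ := by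
        rw [Function.iterate_succ_apply', hn, eq_bot_iff]; exact pw_le
      rw [h1, hn]; simp
    | succ j ih =>
      intro i hi
      refine chain_step (hnorm (i + 2)) (Function.iterate_succ_apply' _ _ _)
        (Function.iterate_succ_apply' _ _ _) (hc i) (ih (i + 1) (by omega))
  have h0 := key n 0 (by omega)
  simp only [Function.iterate_zero, id, zero_add, Function.iterate_one] at h0
  rw [inf_eq_left.2 hH] at h0
  refine exists_gen hG H (pw p H ⊓ pw p N) R inf_le_left ?_
  refine Nat.le_of_mul_le_mul_right (h0.trans ?_) (Nat.card_pos (α := pw p N))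
  calc _ ≤ _ := Nat.mul_le_mul_left _ hR
    _ = _ := by ring

end RBP
namespace RBP

open scoped commutatorElement

/-- `com A n = [A, G, ..., G]` with `n` copies of `G`. -/
def com {G : Type*} [Group G] (A : Subgroup G) : ℕ → Subgroup G
  | 0 => A
  | n + 1 => ⁅com A n, (⊤ : Subgroup G)⁆

theorem com_succ {G : Type*} [Group G] (A : Subgroup G) (n : ℕ) :
    com A (n + 1) = ⁅com A n, (⊤ : Subgroup G)⁆ := rfl

theorem com_normal {G : Type*} [Group G] {A : Subgroup G} (hA : A.Normal) (n : ℕ) :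
    (com A n).Normal := by
  induction n with
  | zero => exact hA
  | succ n ih => rw [com_succ]; infer_instance

theorem com_mono {G : Type*} [Group G] {A B : Subgroup G} (h : A ≤ B) (n : ℕ) :
    com A n ≤ com B n := by
  induction n with
  | zero => exact h
  | succ n ih => exact Subgroup.commutator_mono ih le_rfl

theorem com_succ_le {G : Type*} [Group G] {A : Subgroup G} (hA : A.Normal) (n : ℕ) :
    com A (n + 1) ≤ com A n := by
  have := com_normal hA n
  exact Subgroup.commutator_le_left _ _

theorem com_add {G : Type*} [Group G] (A : Subgroup G) (m n : ℕ) :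
    com (com A m) n = com A (m + n) := by
  induction n with
  | zero => rfl
  | succ n ih => rw [com_succ, ih]; rfl

theorem map_com {G Q : Type*} [Group G] [Group Q] (f : G →* Q) (hf : Function.Surjective f)
    (A : Subgroup G) (n : ℕ) : (com A n).map f = com (A.map f) n := by
  induction n with
  | zero => rfl
  | succ n ih =>
    rw [com_succ, com_succ, Subgroup.map_commutator, ih, Subgroup.map_top_of_surjective f hf]

theorem com_inv {G : Type*} [Group G] {A : Subgroup G} {α : G →* G}
    (hA : A ≤ A.comap α) (n : ℕ) : com A n ≤ (com A n).comap α := by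
  induction n with
  | zero => exact hA
  | succ n ih =>
    rw [com_succ, ← Subgroup.map_le_iff_le_comap, Subgroup.map_commutator]
    exact Subgroup.commutator_mono (Subgroup.map_le_iff_le_comap.2 ih) le_top

theorem com_top_bot {p : ℕ} [Fact p.Prime] {G : Type*} [Group G] [Finite G]
    (hG : IsPGroup p G) : ∃ n, com (⊤ : Subgroup G) n = ⊥ := by
  have := hG.isNilpotent
  obtain ⟨n, hn⟩ := Subgroup.nilpotent_iff_lowerCentralSeries.1 this
  refine ⟨n, hn ▸ ?_⟩
  clear hn
  induction n with
  | zero => rfl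
  | succ n ih => rw [com_succ, ih]; rfl

/-- the preimage of the centre of `G / M`. -/
def zmod {G : Type*} [Group G] (M : Subgroup G) [M.Normal] : Subgroup G :=
  (Subgroup.center (G ⧸ M)).comap (QuotientGroup.mk' M)

theorem mem_zmod {G : Type*} [Group G] {M : Subgroup G} [M.Normal] {x : G} :
    x ∈ zmod M ↔ ∀ g, ⁅x, g⁆ ∈ M := by
  rw [zmod, Subgroup.mem_comap, Subgroup.mem_center_iff]
  constructor
  · intro h g
    rw [← QuotientGroup.eq_one_iff]
    change QuotientGroup.mk' M _ = 1
    rw [map_commutatorElement, commutatorElement_eq_one_iff_mul_comm]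
    exact (h _).symm
  · intro h g
    obtain ⟨g, rfl⟩ := QuotientGroup.mk'_surjective M g
    symm
    rw [← commutatorElement_eq_one_iff_mul_comm, ← map_commutatorElement]
    exact (QuotientGroup.eq_one_iff _).2 (h g)

theorem le_zmod {G : Type*} [Group G] {M X : Subgroup G} [M.Normal] :
    X ≤ zmod M ↔ ⁅X, (⊤ : Subgroup G)⁆ ≤ M := by
  rw [Subgroup.commutator_le]
  constructor
  · intro h x hx g _; exact mem_zmod.1 (h hx) g
  · intro h x hx; exact mem_zmod.2 fun g => h x hx g trivial

theorem mem_zmod_of_gen {G : Type*} [Group G] {M : Subgroup G} [M.Normal] {x : G} (S : Set G)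
    (hS : Subgroup.closure S = ⊤) (h : ∀ s ∈ S, ⁅x, s⁆ ∈ M) : x ∈ zmod M := by
  have h1 : Subgroup.closure S ≤
      (Subgroup.centralizer {QuotientGroup.mk' M x}).comap (QuotientGroup.mk' M) := by
    rw [Subgroup.closure_le]
    intro s hs
    rw [SetLike.mem_coe, Subgroup.mem_comap, Subgroup.mem_centralizer_singleton_iff]
    symm
    rw [← commutatorElement_eq_one_iff_mul_comm, ← map_commutatorElement]
    exact (QuotientGroup.eq_one_iff _).2 (h s hs)
  rw [hS] at h1
  rw [mem_zmod]
  intro g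
  have h2 := h1 (Subgroup.mem_top g)
  rw [Subgroup.mem_comap, Subgroup.mem_centralizer_singleton_iff] at h2
  rw [← QuotientGroup.eq_one_iff]
  change QuotientGroup.mk' M _ = 1
  rw [map_commutatorElement, commutatorElement_eq_one_iff_mul_comm]
  exact h2.symm

theorem three_subgroups {G : Type*} [Group G] {H₁ H₂ H₃ X : Subgroup G} (hX : X.Normal)
    (h1 : ⁅⁅H₂, H₃⁆, H₁⁆ ≤ X) (h2 : ⁅⁅H₃, H₁⁆, H₂⁆ ≤ X) : ⁅⁅H₁, H₂⁆, H₃⁆ ≤ X := by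
  have key : ∀ Y : Subgroup G, Y ≤ X ↔ Y.map (QuotientGroup.mk' X) = ⊥ := by
    intro Y
    rw [Subgroup.map_eq_bot_iff, QuotientGroup.ker_mk']
  rw [key] at *
  simp only [Subgroup.map_commutator] at *
  exact Subgroup.commutator_commutator_eq_bot_of_rotate h1 h2

theorem comm_lcs {G : Type*} [Group G] (n : ℕ) : ∀ {A : Subgroup G}, A.Normal →
    ⁅A, com (⊤ : Subgroup G) n⁆ ≤ com A (n + 1) := by
  induction n with
  | zero => intro A _; exact le_rfl
  | succ n ih =>
    intro A hA
    rw [Subgroup.commutator_comm, com_succ ⊤]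
    refine three_subgroups (com_normal hA _) ?_ ?_
    · rw [Subgroup.commutator_comm ⊤ A]
      have := ih (com_normal hA 1)
      rw [com_add] at this
      rw [show n + 1 + 1 = 1 + (n + 1) by ring]
      exact this
    · exact Subgroup.commutator_mono (ih hA) le_rfl

theorem lcs_gen {G : Type*} [Group G] (r : ℕ) (S : Finset G) (hSr : S.card ≤ r)
    (hS : Subgroup.closure (S : Set G) = ⊤) (i : ℕ) :
    ∃ T : Finset G, T.card ≤ r ^ (i + 1) ∧
      Subgroup.closure (T : Set G) ⊔ com ⊤ (i + 1) = com ⊤ i := by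
  classical
  induction i with
  | zero => exact ⟨S, by simpa using hSr, by rw [hS]; simp [com]⟩
  | succ i ih =>
    obtain ⟨T, hT, hTe⟩ := ih
    let T' : Finset G := (T ×ˢ S).image fun x => ⁅x.1, x.2⁆
    refine ⟨T', ?_, ?_⟩
    · refine Finset.card_image_le.trans ?_
      rw [Finset.card_product, pow_succ]
      exact Nat.mul_le_mul hT hSr
    have hle : Subgroup.closure (T' : Set G) ⊔ com ⊤ (i + 1 + 1) ≤ com ⊤ (i + 1) := by
      refine sup_le ?_ (com_succ_le inferInstance _)
      rw [Subgroup.closure_le]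
      intro y hy
      simp only [T', Finset.coe_image, Set.mem_image, Finset.mem_coe, Finset.mem_product] at hy
      obtain ⟨⟨t, s⟩, ⟨ht, -⟩, rfl⟩ := hy
      refine Subgroup.commutator_mem_commutator ?_ trivial
      rw [← hTe]
      exact Subgroup.mem_sup_left (Subgroup.subset_closure ht)
    refine le_antisymm hle ?_
    set M := Subgroup.closure (T' : Set G) ⊔ com ⊤ (i + 1 + 1) with hM
    have hMn : M.Normal := by
      rw [← Subgroup.commutator_top_right_le_iff]
      exact (Subgroup.commutator_mono hle le_rfl).trans le_sup_right
    rw [com_succ, ← le_zmod, ← hTe]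
    refine sup_le ?_ ?_
    · rw [Subgroup.closure_le]
      intro t ht
      refine mem_zmod_of_gen _ hS fun s hs => ?_
      refine Subgroup.mem_sup_left (Subgroup.subset_closure ?_)
      simp only [T', Finset.coe_image, Set.mem_image, Finset.mem_coe, Finset.mem_product]
      exact ⟨(t, s), ⟨ht, hs⟩, rfl⟩
    · rw [le_zmod]; exact le_sup_right

theorem lift_gen {G : Type*} [Group G] (H L : Subgroup G) [L.Normal] (n : ℕ)
    (h : ∃ T : Finset (G ⧸ L), T.card ≤ n ∧
      Subgroup.closure (T : Set (G ⧸ L)) = H.map (QuotientGroup.mk' L)) :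
    ∃ T : Finset G, T.card ≤ n ∧ Subgroup.closure (T : Set G) ⊔ (H ⊓ L) = H := by
  classical
  obtain ⟨T, hT, hTe⟩ := h
  have hl : ∀ t : G ⧸ L, ∃ x : G, t ∈ T → x ∈ H ∧ QuotientGroup.mk' L x = t := by
    intro t
    by_cases ht : t ∈ T
    · have : t ∈ H.map (QuotientGroup.mk' L) := hTe ▸ Subgroup.subset_closure ht
      obtain ⟨x, hx, hxt⟩ := this
      exact ⟨x, fun _ => ⟨hx, hxt⟩⟩
    · exact ⟨1, fun h => absurd h ht⟩
  choose g hg using hl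
  have hle : Subgroup.closure ((T.image g : Finset G) : Set G) ≤ H := by
    rw [Subgroup.closure_le, Finset.coe_image]
    rintro _ ⟨t, ht, rfl⟩
    exact (hg t ht).1
  have hmap : (Subgroup.closure ((T.image g : Finset G) : Set G)).map (QuotientGroup.mk' L)
      = H.map (QuotientGroup.mk' L) := by
    rw [MonoidHom.map_closure, ← hTe, Finset.coe_image, Set.image_image]
    congr 1
    ext y
    constructor
    · rintro ⟨t, ht, rfl⟩; simp only [(hg t ht).2]; exact ht
    · intro hy; exact ⟨y, hy, (hg y hy).2⟩
  refine ⟨T.image g, Finset.card_image_le.trans hT, le_antisymm (sup_le hle inf_le_left) ?_⟩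
  intro x hx
  have : QuotientGroup.mk' L x ∈ H.map (QuotientGroup.mk' L) := ⟨x, hx, rfl⟩
  rw [← hmap] at this
  obtain ⟨y, hy, hyx⟩ := this
  have h1 : y⁻¹ * x ∈ L := QuotientGroup.eq.1 hyx
  have h2 : x = y * (y⁻¹ * x) := by group
  rw [h2]
  exact Subgroup.mul_mem_sup hy ⟨H.mul_mem (H.inv_mem (hle hy)) hx, h1⟩

theorem card_le_of_sup {p : ℕ} [Fact p.Prime] {G : Type*} [Group G] [Finite G]
    {N X : Subgroup G} (hX : X.Normal) (hXN : X ≤ N) (hc : ⁅N, N⁆ ≤ X) (hp : pw p N ≤ X)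
    {R : ℕ} (T : Finset G) (hT : T.card ≤ R) (hTe : Subgroup.closure (T : Set G) ⊔ X = N) :
    Nat.card N ≤ p ^ R * Nat.card X := by
  classical
  have hpos := (Fact.out : p.Prime).pos
  let f := QuotientGroup.mk' X
  have hN : N.map f = Subgroup.closure ((T.image f : Finset _) : Set (G ⧸ X)) := by
    rw [Finset.coe_image, ← MonoidHom.map_closure, ← hTe, Subgroup.map_sup]
    have : X.map f = ⊥ := by
      rw [Subgroup.map_eq_bot_iff]; simp [f]
    rw [this, sup_bot_eq]
  have h1 := card_closure_le p hpos (T.image f) (by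
    rw [← hN]
    rintro _ ⟨x, hx, rfl⟩ _ ⟨y, hy, rfl⟩
    rw [← commutatorElement_eq_one_iff_mul_comm, ← map_commutatorElement]
    exact (QuotientGroup.eq_one_iff _).2 (hc (Subgroup.commutator_mem_commutator hx hy))) (by
    rw [← hN]
    rintro _ ⟨x, hx, rfl⟩
    rw [← map_pow]
    exact (QuotientGroup.eq_one_iff _).2 (hp (pow_mem_pw hx)))
  rw [← hN] at h1
  have h2 := card_inf_mul X N
  rw [inf_eq_left.2 hXN] at h2
  have h3 : X.relIndex N = Nat.card (N.map f) := by
    rw [← Subgroup.relIndex_ker]; simp [f]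
  rw [← h2, h3, mul_comm]
  exact Nat.mul_le_mul_right _ (h1.trans (Nat.pow_le_pow_right hpos
    (Finset.card_image_le.trans hT)))

/-- rank of an abelian group. -/
theorem abelian_gen {p : ℕ} [Fact p.Prime] {G : Type*} [Group G] [Finite G]
    (hG : IsPGroup p G) {N : Subgroup G} (hN : N.Normal) (hc : ⁅N, N⁆ = ⊥) (T : Finset G)
    (hTe : Subgroup.closure (T : Set G) = N) (H : Subgroup G) (hH : H ≤ N) :
    ∃ T' : Finset G, T'.card ≤ T.card ∧ Subgroup.closure (T' : Set G) = H := by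
  refine chain_gen hG N hN ?_ T.card ?_ H hH
  · intro i
    have : (pw p)^[i] N ≤ N := by
      induction i with
      | zero => exact le_rfl
      | succ n ih => rw [Function.iterate_succ_apply']; exact pw_le.trans ih
    refine (Subgroup.commutator_mono this this).trans ?_
    rw [hc]; exact bot_le
  · refine card_le_of_sup (pw_normal hN) pw_le (by rw [hc]; exact bot_le) le_rfl T le_rfl ?_
    rw [hTe]; exact sup_eq_left.2 pw_le

/-- rank bound for `G / γ_m(G)`. -/
def rk (r m : ℕ) : ℕ := ∑ i ∈ Finset.range m, r ^ (i + 1)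

theorem nilp_gen {p : ℕ} [Fact p.Prime] {G : Type*} [Group G] [Finite G]
    (hG : IsPGroup p G) (r : ℕ) (S : Finset G) (hSr : S.card ≤ r)
    (hS : Subgroup.closure (S : Set G) = ⊤) (H : Subgroup G) (m : ℕ) :
    ∃ T : Finset G, T.card ≤ rk r m ∧
      Subgroup.closure (T : Set G) ⊔ (H ⊓ com ⊤ m) = H := by
  classical
  induction m with
  | zero => exact ⟨∅, by simp, by simp [com]⟩
  | succ m ih =>
    obtain ⟨T, hT, hTe⟩ := ih
    obtain ⟨U, hU, hUe⟩ := lcs_gen r S hSr hS m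
    have hn : (com (⊤ : Subgroup G) m).Normal := com_normal inferInstance m
    have hn' : (com (⊤ : Subgroup G) (m + 1)).Normal := com_normal inferInstance (m + 1)
    let f := QuotientGroup.mk' (com (⊤ : Subgroup G) (m + 1))
    have hf : Function.Surjective f := QuotientGroup.mk'_surjective _
    have hbot : (com (⊤ : Subgroup G) (m + 1)).map f = ⊥ := by
      rw [Subgroup.map_eq_bot_iff]; simp [f]
    obtain ⟨T', hT', hTe'⟩ := lift_gen (H ⊓ com ⊤ m) (com ⊤ (m + 1)) (r ^ (m + 1)) (by
      obtain ⟨T', h1, h2⟩ := abelian_gen (hG.to_quotient (com ⊤ (m + 1)))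
        (N := (com ⊤ m).map f) (hn.map f hf) (by
          rw [← Subgroup.map_commutator, eq_bot_iff, ← hbot]
          exact Subgroup.map_mono (Subgroup.commutator_mono le_rfl le_top)) (U.image f) (by
          rw [Finset.coe_image, ← MonoidHom.map_closure, ← hUe, Subgroup.map_sup, hbot,
            sup_bot_eq]) ((H ⊓ com ⊤ m).map f) (Subgroup.map_mono inf_le_right)
      exact ⟨T', h1.trans (Finset.card_image_le.trans hU), h2⟩)
    refine ⟨T ∪ T', (Finset.card_union_le _ _).trans ?_, ?_⟩
    · rw [rk, Finset.sum_range_succ]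
      exact Nat.add_le_add hT hT'
    · rw [Finset.coe_union, Subgroup.closure_union, sup_assoc]
      rw [inf_assoc, inf_eq_right.2 (com_succ_le inferInstance m)] at hTe'
      rw [hTe', hTe]

/-- if the centralizer of `G` in `A` has index at most `p ^ m`. -/
theorem com_bot {p : ℕ} [Fact p.Prime] {G : Type*} [Group G] [Finite G]
    (hG : IsPGroup p G) {A : Subgroup G} (hA : A.Normal) (m : ℕ)
    (hm : Nat.card A ≤ p ^ m * Nat.card (Subgroup.center G ⊓ A : Subgroup G)) :
    com A (m + 1) = ⊥ := by
  have hp := (Fact.out : p.Prime)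
  set Z := Subgroup.center G ⊓ A with hZ
  have hZc : ∀ X : Subgroup G, ⁅X ⊔ Z, (⊤ : Subgroup G)⁆ = ⁅X, ⊤⁆ := by
    intro X
    refine le_antisymm ?_ (Subgroup.commutator_mono le_sup_left le_rfl)
    have hn : (⁅X, (⊤ : Subgroup G)⁆).Normal := by
      rw [← Subgroup.commutator_top_right_le_iff]
      rw [Subgroup.commutator_comm]
      have := Subgroup.normalizer_commutator_ge_right X (⊤ : Subgroup G)
      rwa [Subgroup.le_normalizer_iff_commutator_le_right] at this
    rw [← le_zmod]
    refine sup_le (le_zmod.2 le_rfl) (le_zmod.2 ?_)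
    have : ⁅Z, (⊤ : Subgroup G)⁆ = ⊥ := by
      rw [Subgroup.commutator_top_right_eq_bot_iff_le_center]; exact inf_le_left
    rw [this]; exact bot_le
  have hcle : ∀ i, com A i ≤ A := by
    intro i
    induction i with
    | zero => exact le_rfl
    | succ n ih => exact (com_succ_le hA n).trans ih
  have key : ∀ i, com A i ≤ Z ∨ p ^ i * Nat.card (com A i ⊔ Z : Subgroup G) ≤ Nat.card A := by
    intro i
    induction i with
    | zero =>
      right
      simp only [com, pow_zero, one_mul]
      exact Subgroup.card_le_of_le (sup_le le_rfl inf_le_right)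
    | succ i ih =>
      rcases ih with h | h
      · exact Or.inl ((com_succ_le hA i).trans h)
      by_cases he : com A (i + 1) ⊔ Z = com A i ⊔ Z
      · left
        have h1 : com A (i + 2) = com A (i + 1) := by
          rw [com_succ A (i + 1), ← hZc, he, hZc]; rfl
        have h2 : ∀ j, com A (i + 1 + j) = com A (i + 1) := by
          intro j
          induction j with
          | zero => rfl
          | succ j ihj => rw [← add_assoc, com_succ, ihj]; exact h1
        obtain ⟨n, hn⟩ := com_top_bot hG
        have h3 : com A (i + 1 + n) ≤ ⊥ := by
          rw [add_comm, ← hn]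
          have : ∀ j, com A (n + j) ≤ com ⊤ n := by
            intro j
            induction j with
            | zero => exact com_mono le_top n
            | succ j ihj => exact (com_succ_le hA _).trans ihj
          exact this _
        rw [h2] at h3
        exact h3.trans bot_le
      · right
        have hlt : com A (i + 1) ⊔ Z < com A i ⊔ Z :=
          lt_of_le_of_ne (sup_le_sup_right (com_succ_le hA i) _) he
        have := card_lt_step hG hlt
        calc _ = p ^ i * (p * Nat.card (com A (i + 1) ⊔ Z : Subgroup G)) := by ring
          _ ≤ _ := Nat.mul_le_mul_left _ this
          _ ≤ _ := h
  have hle : com A m ≤ Z := by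
    rcases key m with h | h
    · exact h
    · have h1 := h.trans hm
      have h2 := Nat.le_of_mul_le_mul_left h1 (pow_pos hp.pos m)
      have h3 := Subgroup.eq_of_le_of_card_ge (le_sup_right : Z ≤ com A m ⊔ Z) h2
      rw [h3]; exact le_sup_left
  rw [com_succ, Subgroup.commutator_top_right_eq_bot_iff_le_center]
  exact hle.trans inf_le_left

end RBP
namespace RBP

open scoped commutatorElement

/-- The hypothesis of the theorem, for an endomorphism. -/
def Hyp {G : Type*} [Group G] (α : G →* G) (r : ℕ) : Prop :=
  Subgroup.closure {x : G | ∃ g : G, x = g⁻¹ * α g} = ⊤ ∧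
  ∀ S : Set G, S ⊆ {x : G | ∃ g : G, x = g⁻¹ * α g} →
    ∃ T : Finset G, T.card ≤ r ∧ Subgroup.closure (T : Set G) = Subgroup.closure S

theorem Hyp.quotient {G : Type*} [Group G] {α : G →* G} {r : ℕ} (h : Hyp α r)
    (B : Subgroup G) [B.Normal] (hB : B ≤ B.comap α) :
    Hyp (QuotientGroup.map B B α hB) r := by
  classical
  let f := QuotientGroup.mk' B
  have hf : Function.Surjective f := QuotientGroup.mk'_surjective _
  have hI : {x : G ⧸ B | ∃ g, x = g⁻¹ * QuotientGroup.map B B α hB g} =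
      f '' {x : G | ∃ g : G, x = g⁻¹ * α g} := by
    ext x
    constructor
    · rintro ⟨g, rfl⟩
      obtain ⟨g, rfl⟩ := hf g
      exact ⟨g⁻¹ * α g, ⟨g, rfl⟩, rfl⟩
    · rintro ⟨_, ⟨g, rfl⟩, rfl⟩
      exact ⟨f g, rfl⟩
  constructor
  · rw [hI, ← MonoidHom.map_closure, h.1, Subgroup.map_top_of_surjective f hf]
  · intro S hS
    rw [hI] at hS
    obtain ⟨S', hS', rfl⟩ := Set.subset_image_iff.1 hS
    obtain ⟨T, hT, hTe⟩ := h.2 S' hS'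
    refine ⟨T.image f, Finset.card_image_le.trans hT, ?_⟩
    rw [Finset.coe_image, ← MonoidHom.map_closure, ← MonoidHom.map_closure, hTe]

theorem centralizer_index {p : ℕ} [Fact p.Prime] {G : Type*} [Group G] [Finite G]
    {α : G →* G} {r : ℕ} (h : Hyp α r) {A : Subgroup G} (hA : A.Normal)
    (hinv : A ≤ A.comap α) (hc : ⁅A, A⁆ = ⊥) (hexp : ∀ a ∈ A, a ^ p ^ 2 = 1) (g : G) :
    (Subgroup.centralizer {g⁻¹ * α g}).relIndex A ≤ p ^ (4 * r) := by
  have hpos := (Fact.out : p.Prime).pos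
  have hcomm : ∀ x ∈ A, ∀ y ∈ A, x * y = y * x := by
    intro x hx y hy
    rw [← commutatorElement_eq_one_iff_mul_comm, ← Subgroup.mem_bot, ← hc]
    exact Subgroup.commutator_mem_commutator hx hy
  let ψ : A →* G :=
    { toFun := fun a => (a : G)⁻¹ * α a
      map_one' := by simp
      map_mul' := by
        intro x y
        have h1 := hcomm _ (A.inv_mem x.2) _ (A.inv_mem y.2)
        have h2 := hcomm _ (A.inv_mem y.2) _ (hinv x.2)
        simp only [Subgroup.coe_mul, map_mul, mul_inv_rev]
        calc (y : G)⁻¹ * (x : G)⁻¹ * (α x * α y) = (x : G)⁻¹ * ((y : G)⁻¹ * α x) * α y := by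
              rw [← h1]; group
          _ = _ := by rw [h2]; group }
  have hψA : ψ.range ≤ A := by
    rintro _ ⟨a, rfl⟩
    exact A.mul_mem (A.inv_mem a.2) (hinv a.2)
  obtain ⟨T, hT, hTe⟩ := h.2 (ψ.range : Set G) (by
    rintro _ ⟨a, rfl⟩
    exact ⟨a, rfl⟩)
  rw [Subgroup.closure_eq] at hTe
  have hcard : Nat.card ψ.range ≤ p ^ (2 * r) := by
    rw [← hTe]
    refine (card_closure_le (p ^ 2) (pow_pos hpos 2) T ?_ ?_).trans ?_
    · rw [hTe]; exact fun x hx y hy => hcomm x (hψA hx) y (hψA hy)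
    · rw [hTe]; exact fun x hx => hexp x (hψA hx)
    · rw [← pow_mul]; exact Nat.pow_le_pow_right hpos (by omega)
  -- the fixed points of `α`
  let F : Subgroup G := α.eqLocus (MonoidHom.id G)
  have hF : F.relIndex A ≤ p ^ (2 * r) := by
    have : F.subgroupOf A = ψ.ker := by
      ext a
      rw [Subgroup.mem_subgroupOf, MonoidHom.mem_ker]
      change α a = a ↔ (a : G)⁻¹ * α a = 1
      rw [inv_mul_eq_one, eq_comm]
    rw [Subgroup.relIndex, this, Subgroup.index_ker]
    exact hcard
  let c : G →* G := (MulAut.conj g⁻¹).toMonoidHom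
  have hcinj : Function.Injective c := (MulAut.conj g⁻¹).injective
  have hAc : A.map c = A := by
    have := hA
    exact Subgroup.Normal.map_conj_eq A g⁻¹
  have hF2 : (F.map c).relIndex A ≤ p ^ (2 * r) := by
    have h1 := Subgroup.relIndex_map_map_of_injective F A hcinj
    rw [hAc] at h1
    rw [h1]; exact hF
  have hle : F ⊓ F.map c ≤ Subgroup.centralizer {g⁻¹ * α g} := by
    rintro a ⟨ha, b, hb, hba⟩
    rw [Subgroup.mem_centralizer_singleton_iff]
    have ha' : α a = a := ha
    have hb' : α b = b := hb
    have hba' : g⁻¹ * b * g = a := by simpa [c] using hba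
    have h1 : b = g * a * g⁻¹ := by rw [← hba']; group
    have h2 : (α g)⁻¹ * b * α g = a := by
      rw [← ha', ← hba', map_mul, map_mul, map_inv, hb']
    have h3 : b * α g = α g * a := by rw [← h2]; group
    calc a * (g⁻¹ * α g) = g⁻¹ * (b * α g) := by rw [h1]; group
      _ = _ := by rw [h3]; group
  calc (Subgroup.centralizer {g⁻¹ * α g}).relIndex A ≤ (F ⊓ F.map c).relIndex A :=
        Subgroup.relIndex_le_of_le_left hle Subgroup.index_ne_zero_of_finite
    _ ≤ _ := Subgroup.relIndex_inf_le
    _ ≤ p ^ (2 * r) * p ^ (2 * r) := Nat.mul_le_mul hF hF2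
    _ = _ := by rw [← pow_add]; congr 1; ring

theorem abelian_com {p : ℕ} [Fact p.Prime] {G : Type*} [Group G] [Finite G]
    (hG : IsPGroup p G) {α : G →* G} {r : ℕ} (h : Hyp α r) {A : Subgroup G} (hA : A.Normal)
    (hinv : A ≤ A.comap α) (hc : ⁅A, A⁆ = ⊥) (hexp : ∀ a ∈ A, a ^ p ^ 2 = 1) :
    com A (4 * r * r + 1) = ⊥ := by
  classical
  have hpos := (Fact.out : p.Prime).pos
  obtain ⟨T₀, hT₀, hTe₀⟩ := h.2 _ le_rfl
  rw [h.1] at hTe₀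
  obtain ⟨T, hTI, hT, hTe⟩ := burnside hG r ((card_le_frattini hG T₀ hTe₀).trans
    (Nat.mul_le_mul_right _ (Nat.pow_le_pow_right hpos hT₀))) _ h.1
  refine com_bot hG hA _ ?_
  have key : ∀ U : Finset G, (U : Set G) ⊆ {x : G | ∃ g : G, x = g⁻¹ * α g} →
      (Subgroup.centralizer (U : Set G)).relIndex A ≤ (p ^ (4 * r)) ^ U.card := by
    intro U
    induction U using Finset.induction_on with
    | empty =>
      intro _
      have h0 : Subgroup.centralizer ((∅ : Finset G) : Set G) = ⊤ := by
        ext; simp [Subgroup.mem_centralizer_iff]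
      rw [h0, Subgroup.relIndex_top_left]; simp
    | insert x U hx ih =>
      intro hU
      rw [Finset.coe_insert] at hU ⊢
      obtain ⟨g, hg⟩ := hU (Set.mem_insert _ _)
      have h1 := ih ((Set.subset_insert _ _).trans hU)
      have h2 := centralizer_index (p := p) h hA hinv hc hexp g
      rw [← hg] at h2
      have h3 : Subgroup.centralizer {x} ⊓ Subgroup.centralizer (U : Set G) ≤
          Subgroup.centralizer (insert x (U : Set G)) := by
        rintro a ⟨ha, hb⟩ y (rfl | hy)
        · exact ha _ rfl
        · exact hb y hy
      rw [Finset.card_insert_of_notMem hx]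
      calc _ ≤ _ := Subgroup.relIndex_le_of_le_left h3 Subgroup.index_ne_zero_of_finite
        _ ≤ _ := Subgroup.relIndex_inf_le
        _ ≤ p ^ (4 * r) * (p ^ (4 * r)) ^ U.card := Nat.mul_le_mul h2 h1
        _ = _ := by ring
  have hk := key T hTI
  rw [← Subgroup.centralizer_closure, hTe, Subgroup.coe_top, Subgroup.centralizer_univ] at hk
  rw [← card_inf_mul (Subgroup.center G) A, mul_comm]
  refine Nat.mul_le_mul_right _ (hk.trans ?_)
  rw [← pow_mul]
  exact Nat.pow_le_pow_right hpos (Nat.mul_le_mul_left _ hT)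

theorem section_com {p : ℕ} [Fact p.Prime] {G : Type*} [Group G] [Finite G]
    (hG : IsPGroup p G) {α : G →* G} {r : ℕ} (h : Hyp α r) {A B : Subgroup G} (hA : A.Normal)
    (hB : B.Normal) (hAinv : A ≤ A.comap α) (hBinv : B ≤ B.comap α)
    (hc : ⁅A, A⁆ ≤ B) (hexp : pw (p ^ 2) A ≤ B) :
    com A (4 * r * r + 1) ≤ B := by
  let f := QuotientGroup.mk' B
  have hf : Function.Surjective f := QuotientGroup.mk'_surjective _
  have hbot : ∀ X : Subgroup G, X ≤ B ↔ X.map f = ⊥ := by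
    intro X
    rw [Subgroup.map_eq_bot_iff]; simp [f]
  rw [hbot, map_com f hf]
  refine abelian_com (hG.to_quotient B) (h.quotient B hBinv) (hA.map f hf) ?_ ?_ ?_
  · rintro _ ⟨a, ha, rfl⟩
    exact ⟨α a, hAinv ha, rfl⟩
  · rw [← Subgroup.map_commutator, ← hbot]; exact hc
  · rintro _ ⟨a, ha, rfl⟩
    rw [← map_pow]
    exact (QuotientGroup.eq_one_iff _).2 (hexp (pow_mem_pw ha))

theorem powerful {p : ℕ} [Fact p.Prime] {G : Type*} [Group G] [Finite G]
    (hG : IsPGroup p G) {α : G →* G} {r : ℕ} (h : Hyp α r) {N : Subgroup G} (hN : N.Normal)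
    (hinv : N ≤ N.comap α) (hNV : N ≤ com ⊤ (2 * (4 * r * r + 1))) :
    ⁅N, N⁆ ≤ pw (p ^ 2) N := by
  set k := 4 * r * r + 1 with hk
  set B := pw (p ^ 2) N with hB
  have hBn : B.Normal := pw_normal hN
  have hBinv : B ≤ B.comap α := pw_inv hinv
  have cinv : ∀ X : Subgroup G, X ≤ X.comap α → (⁅X, X⁆ ⊔ B) ≤ (⁅X, X⁆ ⊔ B).comap α := by
    intro X hX
    rw [← Subgroup.map_le_iff_le_comap] at *
    rw [Subgroup.map_sup, Subgroup.map_commutator]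
    exact sup_le_sup (Subgroup.commutator_mono hX hX) hBinv
  set D := ⁅N, N⁆ ⊔ B with hD
  have hDn : D.Normal := inferInstance
  have hDinv : D ≤ D.comap α := cinv N hinv
  have hDN : D ≤ N := sup_le (Subgroup.commutator_le_left _ _) pw_le
  set D2 := ⁅D, D⁆ ⊔ B with hD2
  have hD2n : D2.Normal := inferInstance
  have h1 : com N k ≤ D := section_com hG h hN hDn hinv hDinv le_sup_left le_sup_right
  have h2 : com D k ≤ D2 := section_com hG h hDn hD2n hDinv (cinv D hDinv) le_sup_left
    ((pw_mono hDN).trans le_sup_right)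
  have h3 : com N (2 * k) ≤ D2 := by
    rw [two_mul, ← com_add]
    exact (com_mono h1 k).trans h2
  have h4 : ⁅N, N⁆ ≤ D2 :=
    (Subgroup.commutator_mono le_rfl hNV).trans
      ((comm_lcs (2 * k) hN).trans ((com_succ_le hN _).trans h3))
  have h5 : D ≤ D2 := sup_le h4 le_sup_right
  have h6 : ∀ n, D ≤ com ⊤ n ⊔ B := by
    intro n
    induction n with
    | zero => exact le_top.trans le_sup_left
    | succ n ih =>
      have hn' : (com (⊤ : Subgroup G) (n + 1)).Normal := com_normal inferInstance (n + 1)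
      refine h5.trans (sup_le ?_ le_sup_right)
      refine (Subgroup.commutator_mono ih le_top).trans ?_
      rw [← le_zmod]
      refine sup_le (le_zmod.2 le_sup_left) (le_zmod.2 ?_)
      exact (Subgroup.commutator_le_left _ _).trans le_sup_right
  obtain ⟨n, hn⟩ := com_top_bot hG
  have h7 := h6 n
  rw [hn, bot_sup_eq] at h7
  exact le_sup_left.trans h7

theorem main {p : ℕ} [Fact p.Prime] {G : Type*} [Group G] [Finite G]
    (hG : IsPGroup p G) {α : G →* G} {r : ℕ} (h : Hyp α r) (H : Subgroup G) :
    ∃ T : Finset G, T.card ≤ rk r (2 * (4 * r * r + 1)) +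
      rk r (2 * (4 * r * r + 1) + (4 * r * r + 1)) ∧ Subgroup.closure (T : Set G) = H := by
  classical
  set k := 4 * r * r + 1 with hk
  obtain ⟨S, hS, hSe⟩ := h.2 _ le_rfl
  rw [h.1] at hSe
  set V := com (⊤ : Subgroup G) (2 * k) with hV
  have hVn : V.Normal := com_normal inferInstance _
  have hVinv : V ≤ V.comap α := com_inv le_top _
  have hW : ∀ i, ((pw p)^[i] V).Normal ∧ (pw p)^[i] V ≤ ((pw p)^[i] V).comap α ∧
      (pw p)^[i] V ≤ V := by
    intro i
    induction i with
    | zero => exact ⟨hVn, hVinv, le_rfl⟩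
    | succ i ih =>
      rw [Function.iterate_succ_apply']
      exact ⟨pw_normal ih.1, pw_inv ih.2.1, pw_le.trans ih.2.2⟩
  have hcomm : ∀ i, ⁅(pw p)^[i] V, (pw p)^[i] V⁆ ≤ (pw p)^[i + 2] V := by
    intro i
    rw [Function.iterate_succ_apply', Function.iterate_succ_apply']
    exact (powerful hG h (hW i).1 (hW i).2.1 (hW i).2.2).trans pw_sq_le
  have hcard : Nat.card V ≤ p ^ (rk r (2 * k + k)) * Nat.card (pw p V) := by
    obtain ⟨T, hT, hTe⟩ := nilp_gen hG r S hS hSe V (2 * k + k)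
    have hle : com (⊤ : Subgroup G) (2 * k + k) ≤ pw p V := by
      rw [← com_add]
      exact section_com hG h hVn (pw_normal hVn) hVinv (pw_inv hVinv)
        ((hcomm 0).trans pw_le) (pw_sq_le.trans pw_le)
    refine card_le_of_sup (pw_normal hVn) pw_le ((hcomm 0).trans pw_le) le_rfl T hT ?_
    refine le_antisymm (sup_le ?_ pw_le) ?_
    · conv_rhs => rw [← hTe]
      exact le_sup_left
    · conv_lhs => rw [← hTe]
      exact sup_le_sup_left (inf_le_right.trans hle) _
  obtain ⟨T₁, hT₁, hTe₁⟩ := nilp_gen hG r S hS hSe H (2 * k)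
  obtain ⟨T₂, hT₂, hTe₂⟩ := chain_gen hG V hVn hcomm _ hcard (H ⊓ V) inf_le_right
  refine ⟨T₁ ∪ T₂, (Finset.card_union_le _ _).trans (Nat.add_le_add hT₁ hT₂), ?_⟩
  rw [Finset.coe_union, Subgroup.closure_union, hTe₂, hTe₁]

end RBP

/-- Proposition 4.6: There is `f : ℕ → ℕ` such that if a finite `p`-group `G` admits a
coprime automorphism `α` with `G = [G,α]` and every subgroup generated by a subset of
`I_G(α)` can be generated by at most `r` elements, then the rank of `G` is at most `f r`. -/
theorem rank_bounded_p_group :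
    ∃ f : ℕ → ℕ,
      ∀ (p : ℕ), p.Prime →
      ∀ (G : Type*) [Group G] [Finite G], IsPGroup p G →
        ∀ (α : MulAut G) (r : ℕ),
          Nat.Coprime (orderOf α) (Nat.card G) →
          Subgroup.closure {x : G | ∃ g : G, x = g⁻¹ * α g} = ⊤ →
          (∀ S : Set G, S ⊆ {x : G | ∃ g : G, x = g⁻¹ * α g} →
            ∃ T : Finset G, T.card ≤ r ∧
              Subgroup.closure (T : Set G) = Subgroup.closure S) →
          ∀ H : Subgroup G,
            ∃ T : Finset G, T.card ≤ f r ∧ Subgroup.closure (T : Set G) = H := by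
  refine ⟨fun r => RBP.rk r (2 * (4 * r * r + 1)) +
    RBP.rk r (2 * (4 * r * r + 1) + (4 * r * r + 1)), ?_⟩
  intro p hp G _ _ hG α r _ hcl hS H
  have : Fact p.Prime := ⟨hp⟩
  exact RBP.main hG (α := α.toMonoidHom) ⟨hcl, hS⟩ H
end
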